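/- Let T̂ be the reference triangle and k ≥ 3. Then dim 𝒱^k(T̂) = dim (H^2×H^1)_{k,k−1}(∂T̂) + dim P_{k−4}(T̂) = (k² + 7k − 6)/2. -/

import Mathlib

open MeasureTheory Real Set
open scoped RealInnerProductSpace
noncomputable section

abbrev E2 := EuclideanSpace ℝ (Fin 2)
def stdb2 (i : Fin 2) : E2 := EuclideanSpace.single i 1
def L2on {n : ℕ} (Ω : Set (EuclideanSpace ℝ (Fin n))) (u : EuclideanSpace ℝ (Fin n) → ℝ) : Prop :=
  MemLp u 2 (volume.restrict Ω)
def IsWeakD {n : ℕ} (Ω : Set (EuclideanSpace ℝ (Fin n)))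
    (u v : EuclideanSpace ℝ (Fin n) → ℝ) (d : EuclideanSpace ℝ (Fin n)) : Prop :=
  ∀ φ : EuclideanSpace ℝ (Fin n) → ℝ, ContDiff ℝ (⊤ : ℕ∞) φ → HasCompactSupport φ → tsupport φ ⊆ Ω →
    ∫ x in Ω, u x * fderiv ℝ φ x d = - ∫ x in Ω, v x * φ x
def tri (p : Fin 3 → E2) : Set E2 := interior (convexHull ℝ (range p))
def evec (p : Fin 3 → E2) (i : Fin 3) : E2 := p (i + 2) - p (i + 1)
def elen (p : Fin 3 → E2) (i : Fin 3) : ℝ := ‖evec p i‖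
def tangv (p : Fin 3 → E2) (i : Fin 3) : E2 := (elen p i)⁻¹ • evec p i
def norv (p : Fin 3 → E2) (i : Fin 3) : E2 :=
  EuclideanSpace.single 0 (tangv p i 1) + EuclideanSpace.single 1 (-(tangv p i 0))
def epar (p : Fin 3 → E2) (i : Fin 3) (t : ℝ) : E2 := p (i + 1) + t • evec p i
def ccw (p : Fin 3 → E2) : Prop :=
  0 < (p 1 - p 0) 0 * (p 2 - p 0) 1 - (p 1 - p 0) 1 * (p 2 - p 0) 0
def tau (i j : Fin 3) : ℝ := if i = j + 1 then 0 else 1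

/-- weak derivative on an open interval of `ℝ` -/
def IsWeakD1 (S : Set ℝ) (u v : ℝ → ℝ) : Prop :=
  ∀ φ : ℝ → ℝ, ContDiff ℝ (⊤ : ℕ∞) φ → HasCompactSupport φ → tsupport φ ⊆ S →
    ∫ t in S, u t * deriv φ t = - ∫ t in S, v t * φ t

def MemHedge : ℕ → (ℝ → ℝ) → Prop
  | 0, u => MemLp u 2 (volume.restrict (Ioo (0:ℝ) 1))
  | (k+1), u => MemLp u 2 (volume.restrict (Ioo (0:ℝ) 1)) ∧
      ∃ v, IsWeakD1 (Ioo (0:ℝ) 1) u v ∧ MemHedge k v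

/-- membership of edgewise data in `H²(∂T) × H¹(∂T)` (with pointwise C¹/C⁰ representatives) -/
def MemBdryH2H1 (f g : Fin 3 → ℝ → ℝ) : Prop :=
  ∀ i, MemHedge 2 (f i) ∧ ContDiffOn ℝ 1 (f i) (Icc 0 1) ∧
    MemHedge 1 (g i) ∧ ContinuousOn (g i) (Icc 0 1)

/-- compatibility conditions (2.2)-(2.4) -/
def Compat (p : Fin 3 → E2) (f g : Fin 3 → ℝ → ℝ) : Prop :=
  (∀ i j k : Fin 3, j ≠ i → k ≠ i → f j (tau i j) = f k (tau i k)) ∧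
  ∃ w : Fin 3 → E2, ∀ i j : Fin 3, j ≠ i →
    derivWithin (f j) (Icc 0 1) (tau i j) = elen p j * ⟪w i, tangv p j⟫ ∧
    g j (tau i j) = ⟪w i, norv p j⟫

/-- `H²` membership with explicit weak gradient and Hessian data -/
def MemH2W {n : ℕ} (Ω : Set (EuclideanSpace ℝ (Fin n))) (ξ : EuclideanSpace ℝ (Fin n) → ℝ)
    (G : Fin n → EuclideanSpace ℝ (Fin n) → ℝ)
    (Hs : Fin n → Fin n → EuclideanSpace ℝ (Fin n) → ℝ) : Prop :=
  L2on Ω ξ ∧ (∀ d, L2on Ω (G d) ∧ IsWeakD Ω ξ (G d) (EuclideanSpace.single d 1)) ∧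
  ∀ d d', L2on Ω (Hs d d') ∧ IsWeakD Ω (G d) (Hs d d') (EuclideanSpace.single d' 1)

/-- Gagliardo-type `H^{1/2}` seminorm finiteness for functions on a domain in `ℝⁿ` -/
def GagH12 {n : ℕ} (Ω : Set (EuclideanSpace ℝ (Fin n))) (u : EuclideanSpace ℝ (Fin n) → ℝ) : Prop :=
  Integrable (fun q : EuclideanSpace ℝ (Fin n) × EuclideanSpace ℝ (Fin n) =>
    (u q.1 - u q.2) ^ 2 / ‖q.1 - q.2‖ ^ (n + 1)) ((volume.restrict Ω).prod (volume.restrict Ω))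

/-- membership in `H^{5/2}` of a domain: weak `H²` data whose second derivatives have finite
`H^{1/2}` Gagliardo seminorm. -/
def MemH52 {n : ℕ} (Ω : Set (EuclideanSpace ℝ (Fin n))) (ζ : EuclideanSpace ℝ (Fin n) → ℝ) : Prop :=
  ∃ G Hs, MemH2W Ω ζ G Hs ∧ ∀ d d', GagH12 Ω (Hs d d')

/-- pointwise trace relation `Tr ζ = (f,g)` on `∂T` for a `C¹` function -/
def TraceEq (p : Fin 3 → E2) (ζ : E2 → ℝ) (f g : Fin 3 → ℝ → ℝ) : Prop :=
  ∀ i : Fin 3, ∀ t ∈ Icc (0:ℝ) 1,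
    ζ (epar p i t) = f i t ∧ fderiv ℝ ζ (epar p i t) (norv p i) = g i t

/-- the vector field 𝔤 (2.11) on edge `i`, at parameter `t` -/
def gfield (p : Fin 3 → E2) (f g : Fin 3 → ℝ → ℝ) (i : Fin 3) (t : ℝ) : E2 :=
  ((elen p i)⁻¹ * derivWithin (f i) (Icc 0 1) t) • tangv p i + g i t • norv p i

/-- the Laplacian of a (smooth) function on `E2` -/
def lap (φ : E2 → ℝ) (x : E2) : ℝ :=
  ∑ i : Fin 2, fderiv ℝ (fun y => fderiv ℝ φ y (stdb2 i)) x (stdb2 i)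

/-- `bu` is the edgewise boundary trace of `u` on `∂T` (in the parametrization `epar`),
expressed through the divergence theorem; `Du` is the weak gradient of `u` on `T`. -/
def HasFaceTrace (p : Fin 3 → E2) (u : E2 → ℝ) (Du : Fin 2 → E2 → ℝ)
    (bu : Fin 3 → ℝ → ℝ) : Prop :=
  ∀ φ : E2 → ℝ, ContDiff ℝ (⊤ : ℕ∞) φ → HasCompactSupport φ → ∀ d : Fin 2,
    ∫ x in tri p, (u x * fderiv ℝ φ x (stdb2 d) + Du d x * φ x)
      = ∑ j : Fin 3, elen p j * ∫ t in Ioo (0:ℝ) 1, bu j t * φ (epar p j t) * norv p j d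

/-- `Tr ξ = (f,g)` in the weak (integration by parts) sense: the boundary trace of `ξ`
is `f` and the boundary trace of its gradient is `(∂f/∂t) t + g n` (cf. (2.5), (2.11)). -/
def TraceW (p : Fin 3 → E2) (ξ : E2 → ℝ) (G : Fin 2 → E2 → ℝ)
    (Hs : Fin 2 → Fin 2 → E2 → ℝ) (f g : Fin 3 → ℝ → ℝ) : Prop :=
  HasFaceTrace p ξ G f ∧
  ∀ d : Fin 2, HasFaceTrace p (G d) (fun d' => Hs d d') (fun j t => gfield p f g j t d)
/-- `u : ℝ → ℝ` is a polynomial of degree at most `m` (`{0}` if `m < 0`) -/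
def IsPolyDegLe (m : ℤ) (u : ℝ → ℝ) : Prop :=
  ∃ Q : Polynomial ℝ, (∀ n : ℕ, m < (n : ℤ) → Q.coeff n = 0) ∧ ∀ t, u t = Q.eval t

/-- `u : E2 → ℝ` is a polynomial of total degree at most `m` (`{0}` if `m < 0`) -/
def IsPoly2DegLe (m : ℤ) (u : E2 → ℝ) : Prop :=
  ∃ Q : MvPolynomial (Fin 2) ℝ,
    (∀ d : Fin 2 →₀ ℕ, m < ((d 0 + d 1 : ℕ) : ℤ) → MvPolynomial.coeff d Q = 0) ∧
    ∀ x : E2, u x = MvPolynomial.eval (fun i => x i) Q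

/-- the reference triangle with vertices (0,0), (1,0), (0,1) -/
def refTri : Fin 3 → E2 :=
  ![0, EuclideanSpace.single 0 1, EuclideanSpace.single 1 1]

/-- the distributional bilaplacian of `ξ` on `T` is a polynomial of degree ≤ m -/
def BiharmPoly (p : Fin 3 → E2) (m : ℤ) (ξ : E2 → ℝ) : Prop :=
  ∃ ρ : E2 → ℝ, IsPoly2DegLe m ρ ∧
    ∀ φ : E2 → ℝ, ContDiff ℝ (⊤ : ℕ∞) φ → HasCompactSupport φ → tsupport φ ⊆ tri p →
      ∫ x in tri p, ξ x * lap (lap φ) x = ∫ x in tri p, ρ x * φ x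

/-- `ξ` belongs to the virtual element space `𝒱^k(T)` (defined here for the
reference triangle `p = refTri`), with trace pair `(f,g) ∈ (H²×H¹)_{k,k-1}(∂T)`. -/
def MemVEMT (p : Fin 3 → E2) (k : ℕ) (ξ : E2 → ℝ) (f g : Fin 3 → ℝ → ℝ) : Prop :=
  (∀ i, IsPolyDegLe (k : ℤ) (f i) ∧ IsPolyDegLe ((k : ℤ) - 1) (g i)) ∧
  Compat p f g ∧
  ∃ G Hs, MemH2W (tri p) ξ G Hs ∧ TraceW p ξ G Hs f g ∧ BiharmPoly p ((k : ℤ) - 4) ξ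

/-! ### Geometry of the reference triangle -/

def TT : Set E2 := {x | 0 < x 0 ∧ 0 < x 1 ∧ x 0 + x 1 < 1}
def TC : Set E2 := {x | 0 ≤ x 0 ∧ 0 ≤ x 1 ∧ x 0 + x 1 ≤ 1}

lemma hull_eq : convexHull ℝ (range refTri) = TC := by
  have hr : range refTri = {(0:E2), EuclideanSpace.single 0 1, EuclideanSpace.single 1 1} := by
    ext x
    simp only [mem_range, Fin.exists_fin_succ, refTri]
    simp [eq_comm]
  apply Subset.antisymm
  · apply convexHull_min
    · rw [hr]
      intro x hx
      simp only [mem_insert_iff, mem_singleton_iff] at hx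
      rcases hx with rfl | rfl | rfl <;> simp [TC]
    · intro x hx y hy a b ha hb hab
      simp only [TC, mem_ofPred_eq, PiLp.add_apply, PiLp.smul_apply, smul_eq_mul] at *
      obtain ⟨h1, h2, h3⟩ := hx
      obtain ⟨k1, k2, k3⟩ := hy
      refine ⟨by positivity, by positivity, ?_⟩
      nlinarith
  · rintro x ⟨h1, h2, h3⟩
    have h0 : refTri 0 ∈ convexHull ℝ (range refTri) := subset_convexHull _ _ (mem_range_self _)
    have h01 : refTri 1 ∈ convexHull ℝ (range refTri) := subset_convexHull _ _ (mem_range_self _)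
    have h02 : refTri 2 ∈ convexHull ℝ (range refTri) := subset_convexHull _ _ (mem_range_self _)
    have hx : x = ∑ i : Fin 3, (![1 - x 0 - x 1, x 0, x 1] i) • refTri i := by
      ext j
      fin_cases j <;> simp [Fin.sum_univ_three, refTri]
    rw [hx]
    apply (convex_convexHull ℝ _).sum_mem
    · intro i _
      fin_cases i <;> simp <;> linarith
    · simp [Fin.sum_univ_three]
      ring
    · intro i _
      exact subset_convexHull _ _ (mem_range_self _)

lemma cont_coord (i : Fin 2) : Continuous fun x : E2 => x i := by fun_prop

lemma isOpen_TT : IsOpen TT := by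
  have h0 := cont_coord 0
  have h1 := cont_coord 1
  exact (isOpen_lt continuous_const h0).inter
    ((isOpen_lt continuous_const h1).inter (isOpen_lt (h0.add h1) continuous_const))

lemma isClosed_TC : IsClosed TC := by
  have h0 := cont_coord 0
  have h1 := cont_coord 1
  exact (isClosed_le continuous_const h0).inter
    ((isClosed_le continuous_const h1).inter (isClosed_le (h0.add h1) continuous_const))

lemma TT_sub_TC : TT ⊆ TC := fun _ h => ⟨h.1.le, h.2.1.le, h.2.2.le⟩

lemma tri_eq : tri refTri = TT := by
  rw [tri, hull_eq]
  apply Subset.antisymm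
  · intro x hx
    have key : ∀ v : E2, ∃ t : ℝ, 0 < t ∧ x + t • v ∈ TC := by
      intro v
      have hc : Filter.Tendsto (fun t : ℝ => x + t • v) (nhdsWithin 0 (Ioi 0)) (nhds x) := by
        have : Continuous (fun t : ℝ => x + t • v) := by fun_prop
        have h := this.tendsto 0
        simp only [zero_smul, add_zero] at h
        exact h.mono_left nhdsWithin_le_nhds
      have h1 := hc.eventually (mem_interior_iff_mem_nhds.1 hx)
      have h2 : ∀ᶠ t in nhdsWithin (0:ℝ) (Ioi 0), 0 < t := self_mem_nhdsWithin
      obtain ⟨t, ht1, ht2⟩ := (h2.and h1).exists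
      exact ⟨t, ht1, ht2⟩
    obtain ⟨t, ht, a1, a2, a3⟩ := key (EuclideanSpace.single 0 (-1))
    obtain ⟨s, hs, b1, b2, b3⟩ := key (EuclideanSpace.single 1 (-1))
    obtain ⟨r, hr, c1, c2, c3⟩ := key (EuclideanSpace.single 1 (1))
    simp at a1 a2 a3 b1 b2 b3 c1 c2 c3
    exact ⟨by linarith, by linarith, by linarith⟩
  · exact interior_maximal TT_sub_TC isOpen_TT

lemma isCompact_TC : IsCompact TC := by
  rw [← hull_eq]
  exact (finite_range refTri).isCompact_convexHull ℝ

lemma measurableSet_TT : MeasurableSet TT := isOpen_TT.measurableSet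

lemma volume_TT_lt_top : volume TT < ⊤ :=
  lt_of_le_of_lt (measure_mono TT_sub_TC) isCompact_TC.measure_lt_top

abbrev muT : Measure E2 := volume.restrict TT

instance : IsFiniteMeasure muT := ⟨by simpa using volume_TT_lt_top⟩

/-- the barycentric coordinates -/
def lam (i : Fin 3) (x : E2) : ℝ := ![1 - x 0 - x 1, x 0, x 1] i

/-- their gradients -/
def glam (i : Fin 3) (d : Fin 2) : ℝ := (![![-1, -1], ![1, 0], ![0, 1]] i : Fin 2 → ℝ) d

lemma evec_ref (i : Fin 3) : evec refTri i = (![!₂[-1, 1], !₂[0, -1], !₂[1, 0]] i : E2) := by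
  ext d
  fin_cases i <;> fin_cases d <;> simp [evec, refTri]

lemma elen_pos (i : Fin 3) : 0 < elen refTri i := by
  rw [elen, evec_ref, norm_pos_iff]
  intro h
  fin_cases i
  · have := congrArg (fun v : E2 => v 0) h; simp at this
  · have := congrArg (fun v : E2 => v 1) h; simp at this
  · have := congrArg (fun v : E2 => v 0) h; simp at this

/-- length times normal -/
def nn (i : Fin 3) (d : Fin 2) : ℝ := (![![1, 1], ![-1, 0], ![0, -1]] i : Fin 2 → ℝ) d

lemma elen_norv (i : Fin 3) (d : Fin 2) : elen refTri i * norv refTri i d = nn i d := by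
  have h := (elen_pos i).ne'
  fin_cases d
  · simp only [norv, tangv, evec_ref]
    fin_cases i <;> simp_all [nn]
  · simp only [norv, tangv, evec_ref]
    fin_cases i <;> simp_all [nn]

lemma epar_ref (i : Fin 3) (t : ℝ) :
    epar refTri i t = (![!₂[1 - t, t], !₂[0, 1 - t], !₂[t, 0]] i : E2) := by
  ext d
  fin_cases i <;> fin_cases d <;> simp [epar, evec_ref] <;> simp [refTri] <;> ring

lemma epar_mem_TC (i : Fin 3) {t : ℝ} (ht : t ∈ Icc (0:ℝ) 1) : epar refTri i t ∈ TC := by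
  obtain ⟨h0, h1⟩ := ht
  rw [epar_ref]
  fin_cases i <;> simp [TC] <;> (try constructor) <;> linarith

lemma epar_not_mem_TT (i : Fin 3) (t : ℝ) : epar refTri i t ∉ TT := by
  rw [epar_ref]
  fin_cases i <;> simp [TT]


/-! ### Fubini and the divergence theorem on the triangle -/

def pxy (q : ℝ × ℝ) : E2 := !₂[q.1, q.2]
def pyx (q : ℝ × ℝ) : E2 := !₂[q.2, q.1]

lemma mp_pxy : MeasurePreserving pxy := by
  have h1 := (volume_preserving_finTwoArrow ℝ).symm
  have h2 := PiLp.volume_preserving_toLp (Fin 2)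
  have h := h2.comp h1
  have e : pxy = WithLp.toLp 2 ∘ ⇑(MeasurableEquiv.finTwoArrow (α := ℝ)).symm := by
    funext q
    ext i
    fin_cases i <;> rfl
  rw [e]
  exact h

lemma mp_pyx : MeasurePreserving pyx := by
  have h := mp_pxy.comp (Measure.measurePreserving_swap (μ := (volume : Measure ℝ)) (ν := (volume : Measure ℝ)))
  exact h

lemma emb_pxy : MeasurableEmbedding pxy := by
  have h1 := (MeasurableEquiv.finTwoArrow (α := ℝ)).symm.measurableEmbedding
  have h2 := (MeasurableEquiv.toLp 2 (Fin 2 → ℝ)).measurableEmbedding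
  have h := h2.comp h1
  have e : pxy = (MeasurableEquiv.toLp 2 (Fin 2 → ℝ)) ∘ ⇑(MeasurableEquiv.finTwoArrow (α := ℝ)).symm := by
    funext q
    ext i
    fin_cases i <;> rfl
  rw [e]
  exact h

lemma emb_pyx : MeasurableEmbedding pyx :=
  emb_pxy.comp (MeasurableEquiv.prodComm (α := ℝ) (β := ℝ)).measurableEmbedding

lemma div_gen (P : ℝ × ℝ → E2) (hmp : MeasurePreserving P) (hemb : MeasurableEmbedding P)
    (hc : Continuous P)
    (hT : ∀ x y, P (x, y) ∈ TT ↔ 0 < x ∧ 0 < y ∧ x + y < 1)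
    (hC : ∀ x y, P (x, y) ∈ TC ↔ 0 ≤ x ∧ 0 ≤ y ∧ x + y ≤ 1)
    (W W' : E2 → ℝ) (hW : ContinuousOn W TC) (hW' : IntegrableOn W' TT)
    (hd : ∀ x y, P (x, y) ∈ TT → HasDerivAt (fun s => W (P (s, y))) (W' (P (x, y))) x) :
    ∫ x in TT, W' x = ∫ y in Ioo (0:ℝ) 1, (W (P (1 - y, y)) - W (P (0, y))) := by
  have hi : Integrable (fun q => TT.indicator W' (P q)) := by
    rw [← integrable_indicator_iff measurableSet_TT] at hW'
    exact (hmp.integrable_comp_emb hemb).2 hW'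
  have e1 : ∫ x in TT, W' x = ∫ q : ℝ × ℝ, TT.indicator W' (P q) := by
    rw [← integral_indicator measurableSet_TT]
    exact (hmp.integral_comp hemb _).symm
  rw [e1]
  have e2 : ∫ q : ℝ × ℝ, TT.indicator W' (P q) = ∫ y, ∫ x, TT.indicator W' (P (x, y)) :=
    integral_prod_symm (μ := (volume : Measure ℝ)) (ν := (volume : Measure ℝ)) _ hi
  rw [e2, ← integral_indicator measurableSet_Ioo]
  have hae : ∀ᵐ y : ℝ, Integrable (fun x => TT.indicator W' (P (x, y))) := 
    Integrable.prod_left_ae (μ := (volume : Measure ℝ)) (ν := (volume : Measure ℝ)) hi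
  apply integral_congr_ae
  filter_upwards [hae] with y hy
  by_cases hy01 : y ∈ Ioo (0:ℝ) 1
  · rw [indicator_of_mem hy01]
    have e3 : (fun x => TT.indicator W' (P (x, y))) =
        (Ioo 0 (1 - y)).indicator (fun x => W' (P (x, y))) := by
      funext x
      by_cases hx : P (x, y) ∈ TT
      · rw [indicator_of_mem hx, indicator_of_mem]
        have := (hT _ _).1 hx
        exact ⟨this.1, by linarith⟩
      · rw [indicator_of_notMem hx, indicator_of_notMem]
        intro h
        exact hx ((hT _ _).2 ⟨h.1, hy01.1, by linarith [h.2]⟩)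
    rw [e3] at hy ⊢
    rw [integrable_indicator_iff measurableSet_Ioo] at hy
    rw [integral_indicator measurableSet_Ioo, ← integral_Ioc_eq_integral_Ioo,
      ← intervalIntegral.integral_of_le (by linarith [hy01.2])]
    refine intervalIntegral.integral_eq_sub_of_hasDerivAt_of_le
      (f := fun s => W (P (s, y))) (by linarith [hy01.2]) ?_ ?_ ?_
    · apply hW.comp (by fun_prop)
      intro x hx
      exact (hC _ _).2 ⟨hx.1, hy01.1.le, by linarith [hx.2]⟩
    · intro x hx
      exact hd x y ((hT _ _).2 ⟨hx.1, hy01.1, by linarith [hx.2]⟩)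
    · rw [intervalIntegrable_iff_integrableOn_Ioo_of_le (by linarith [hy01.2])]
      exact hy
  · rw [indicator_of_notMem hy01]
    have : (fun x => TT.indicator W' (P (x, y))) = fun _ => 0 := by
      funext x
      rw [indicator_of_notMem]
      intro h
      have := (hT _ _).1 h
      exact hy01 ⟨this.2.1, by linarith⟩
    rw [this]; simp

lemma div_x (W W' : E2 → ℝ) (hW : ContinuousOn W TC) (hW' : IntegrableOn W' TT)
    (hd : ∀ x ∈ TT, HasDerivAt (fun s : ℝ => W (x + s • stdb2 0)) (W' x) 0) :
    ∫ x in TT, W' x = ∫ y in Ioo (0:ℝ) 1, (W !₂[1 - y, y] - W !₂[0, y]) := by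
  refine div_gen pxy mp_pxy emb_pxy ?_ ?_ ?_ W W' hW hW' ?_
  · unfold pxy; fun_prop
  · intro x y; simp [pxy, TT]
  · intro x y; simp [pxy, TC]
  · intro x y h
    have h1 := hd _ h
    have h2 : HasDerivAt (fun s : ℝ => s - x) 1 x := (hasDerivAt_id x).sub_const x
    have h1' : HasDerivAt (fun s : ℝ => W (pxy (x, y) + s • stdb2 0)) (W' (pxy (x, y))) (x - x) := by
      simpa using h1
    have h3 := HasDerivAt.comp (h := fun s => s - x) x h1' h2
    rw [mul_one] at h3
    refine h3.congr_of_eventuallyEq (Filter.Eventually.of_forall fun s => ?_)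
    simp only [Function.comp]
    congr 1
    ext i; fin_cases i <;> simp [pxy, stdb2]

lemma div_y (W W' : E2 → ℝ) (hW : ContinuousOn W TC) (hW' : IntegrableOn W' TT)
    (hd : ∀ x ∈ TT, HasDerivAt (fun s : ℝ => W (x + s • stdb2 1)) (W' x) 0) :
    ∫ x in TT, W' x = ∫ y in Ioo (0:ℝ) 1, (W !₂[y, 1 - y] - W !₂[y, 0]) := by
  refine div_gen pyx mp_pyx emb_pyx ?_ ?_ ?_ W W' hW hW' ?_
  · unfold pyx; fun_prop
  · intro x y; simp [pyx, TT, add_comm y x]; tauto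
  · intro x y; simp [pyx, TC, add_comm y x]; tauto
  · intro x y h
    have h1 := hd _ h
    have h2 : HasDerivAt (fun s : ℝ => s - x) 1 x := (hasDerivAt_id x).sub_const x
    have h1' : HasDerivAt (fun s : ℝ => W (pyx (x, y) + s • stdb2 1)) (W' (pyx (x, y))) (x - x) := by
      simpa using h1
    have h3 := HasDerivAt.comp (h := fun s => s - x) x h1' h2
    rw [mul_one] at h3
    refine h3.congr_of_eventuallyEq (Filter.Eventually.of_forall fun s => ?_)
    simp only [Function.comp]
    congr 1
    ext i; fin_cases i <;> simp [pyx, stdb2]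

lemma refl_Ioo (h : ℝ → ℝ) : ∫ t in Ioo (0:ℝ) 1, h (1 - t) = ∫ t in Ioo (0:ℝ) 1, h t := by
  rw [← integral_Ioc_eq_integral_Ioo, ← integral_Ioc_eq_integral_Ioo,
    ← intervalIntegral.integral_of_le zero_le_one, ← intervalIntegral.integral_of_le zero_le_one]
  simp

lemma cont_epar (j : Fin 3) : Continuous (epar refTri j) := by unfold epar; fun_prop

lemma integrableOn_edge (W : E2 → ℝ) (hW : ContinuousOn W TC) (j : Fin 3) :
    IntegrableOn (fun t => W (epar refTri j t)) (Ioo (0:ℝ) 1) := by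
  have : ContinuousOn (fun t => W (epar refTri j t)) (Icc (0:ℝ) 1) :=
    hW.comp (cont_epar j).continuousOn (fun t ht => epar_mem_TC j ht)
  exact (this.integrableOn_compact isCompact_Icc).mono_set Ioo_subset_Icc_self

lemma integrableOn_TT (W : E2 → ℝ) (hW : ContinuousOn W TC) : IntegrableOn W TT :=
  (hW.integrableOn_compact isCompact_TC).mono_set TT_sub_TC

/-- divergence theorem in the shape needed for `HasFaceTrace` -/
lemma div_thm (W W' : E2 → ℝ) (hW : ContinuousOn W TC) (hW' : IntegrableOn W' TT) (d : Fin 2)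
    (hd : ∀ x ∈ TT, HasDerivAt (fun s : ℝ => W (x + s • stdb2 d)) (W' x) 0) :
    ∫ x in TT, W' x = ∑ j : Fin 3, nn j d * ∫ t in Ioo (0:ℝ) 1, W (epar refTri j t) := by
  have i0 := integrableOn_edge W hW 0
  have i1 := integrableOn_edge W hW 1
  have i2 := integrableOn_edge W hW 2
  have r1 := refl_Ioo (fun t => W (epar refTri 1 t))
  have r0 := refl_Ioo (fun t => W (epar refTri 0 t))
  have i1' : IntegrableOn (fun t => W !₂[0, t]) (Ioo (0:ℝ) 1) := by
    have : ContinuousOn (fun t => W !₂[0, t]) (Icc (0:ℝ) 1) := by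
      apply hW.comp (by fun_prop)
      intro t ht
      simpa [TC] using ht
    exact (this.integrableOn_compact isCompact_Icc).mono_set Ioo_subset_Icc_self
  have i0' : IntegrableOn (fun t => W !₂[t, 1 - t]) (Ioo (0:ℝ) 1) := by
    have : ContinuousOn (fun t => W !₂[t, 1 - t]) (Icc (0:ℝ) 1) := by
      apply hW.comp (by fun_prop)
      intro t ht
      simpa [TC] using ht
    exact (this.integrableOn_compact isCompact_Icc).mono_set Ioo_subset_Icc_self
  simp only [epar_ref] at *
  simp only [Fin.isValue, Matrix.cons_val_zero, Matrix.cons_val_one, Matrix.cons_val] at *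
  fin_cases d
  · have := div_x W W' hW hW' hd
    rw [this, integral_sub i0 i1']
    simp [Fin.sum_univ_three, nn, sub_eq_add_neg] at r1 ⊢
    linarith
  · have := div_y W W' hW hW' hd
    rw [this, integral_sub i0' i2]
    simp [Fin.sum_univ_three, nn, sub_eq_add_neg] at r0 ⊢
    linarith


/-! ### Regular functions with bounded second derivatives -/

def dl (a : Fin 2 → ℝ) : E2 →L[ℝ] ℝ :=
  a 0 • (EuclideanSpace.proj 0 : E2 →L[ℝ] ℝ) + a 1 • (EuclideanSpace.proj 1 : E2 →L[ℝ] ℝ)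

lemma dl_apply (a : Fin 2 → ℝ) (v : E2) : dl a v = a 0 * v 0 + a 1 * v 1 := by
  simp [dl]

lemma dl_stdb2 (a : Fin 2 → ℝ) (d : Fin 2) : dl a (stdb2 d) = a d := by
  rw [dl_apply]
  fin_cases d <;> simp [stdb2]

lemma bdd_of_compact {φ : E2 → ℝ} (h : Continuous φ) (hc : HasCompactSupport φ) :
    ∃ C, ∀ x, ‖φ x‖ ≤ C := h.bounded_above_of_compact_support hc

lemma int_mul_test {μ : Measure E2} {u φ : E2 → ℝ} (hu : Integrable u μ) (h : Continuous φ)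
    (hc : HasCompactSupport φ) : Integrable (fun x => u x * φ x) μ := by
  obtain ⟨C, hC⟩ := bdd_of_compact h hc
  exact hu.mul_bdd (c := C) h.aestronglyMeasurable (Filter.Eventually.of_forall hC)

lemma cont_pd {φ : E2 → ℝ} (h : ContDiff ℝ (⊤ : ℕ∞) φ) (v : E2) :
    Continuous fun x => fderiv ℝ φ x v := by
  have := h.continuous_fderiv (by simp)
  fun_prop

lemma supp_pd {φ : E2 → ℝ} (h : HasCompactSupport φ) (v : E2) :
    HasCompactSupport fun x => fderiv ℝ φ x v := h.fderiv_apply ℝ v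

lemma faceTrace_of (u : E2 → ℝ) (Du : Fin 2 → E2 → ℝ) (hu : ContinuousOn u TC)
    (hDu : ∀ d, IntegrableOn (Du d) TT)
    (hd : ∀ x ∈ TT, HasFDerivAt u (dl fun d => Du d x) x) :
    HasFaceTrace refTri u Du (fun j t => u (epar refTri j t)) := by
  intro φ hφ hφc d
  rw [tri_eq]
  have hφd : Differentiable ℝ φ := hφ.differentiable (by simp)
  have := div_thm (fun x => u x * φ x) (fun x => u x * fderiv ℝ φ x (stdb2 d) + Du d x * φ x)
    (hu.mul hφ.continuous.continuousOn) ?_ d ?_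
  · rw [this]
    refine Finset.sum_congr rfl fun j _ => ?_
    rw [← elen_norv, integral_mul_const]
    ring
  · exact (int_mul_test (integrableOn_TT u hu) (cont_pd hφ _) (supp_pd hφc _)).add
      (int_mul_test (hDu d) hφ.continuous hφc)
  · intro x hx
    have hl : HasDerivAt (fun s : ℝ => x + s • stdb2 d) (stdb2 d) 0 := by
      have := ((hasDerivAt_id (0:ℝ)).smul_const (stdb2 d)).const_add x
      simpa using this
    have h0 : x + (0:ℝ) • stdb2 d = x := by simp
    have h1 : HasFDerivAt u (dl fun d => Du d x) (x + (0:ℝ) • stdb2 d) := by rw [h0]; exact hd x hx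
    have h2 : HasFDerivAt φ (fderiv ℝ φ x) (x + (0:ℝ) • stdb2 d) := by
      rw [h0]; exact (hφd x).hasFDerivAt
    have h3 := (h1.comp_hasDerivAt (0:ℝ) hl).mul (h2.comp_hasDerivAt (0:ℝ) hl)
    refine HasDerivAt.congr_deriv h3 ?_
    simp only [Function.comp, h0, dl_stdb2]
    ring

lemma HasFaceTrace.congr {p : Fin 3 → E2} {u : E2 → ℝ} {Du : Fin 2 → E2 → ℝ}
    {b b' : Fin 3 → ℝ → ℝ} (h : HasFaceTrace p u Du b)
    (hb : ∀ j, ∀ t ∈ Ioo (0:ℝ) 1, b j t = b' j t) : HasFaceTrace p u Du b' := by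
  intro φ hφ hφc d
  rw [h φ hφ hφc d]
  refine Finset.sum_congr rfl fun j _ => ?_
  congr 1
  refine setIntegral_congr_fun measurableSet_Ioo fun t ht => ?_
  simp only [hb j t ht]

lemma int_of_L2 {u : E2 → ℝ} (h : MemLp u 2 muT) : Integrable u muT :=
  h.integrable (by norm_num)

lemma HasFaceTrace.isWeakD {u : E2 → ℝ} {Du : Fin 2 → E2 → ℝ}
    {b : Fin 3 → ℝ → ℝ} (h : HasFaceTrace refTri u Du b) (hu : Integrable u muT)
    (hDu : ∀ d, Integrable (Du d) muT) (d : Fin 2) : IsWeakD (tri refTri) u (Du d) (stdb2 d) := by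
  intro φ hφ hφc hs
  have h1 := h φ hφ hφc d
  rw [tri_eq] at *
  rw [integral_add (int_mul_test hu (cont_pd hφ _) (supp_pd hφc _))
    (int_mul_test (hDu d) hφ.continuous hφc)] at h1
  have : ∀ j t, φ (epar refTri j t) = 0 := fun j t =>
    image_eq_zero_of_notMem_tsupport fun hm => epar_not_mem_TT j t (hs hm)
  simp only [this, mul_zero, zero_mul, integral_zero, Finset.sum_const_zero] at h1
  linarith

structure Good (ξ : E2 → ℝ) (G : Fin 2 → E2 → ℝ) (Hs : Fin 2 → Fin 2 → E2 → ℝ) : Prop where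
  c0 : ContinuousOn ξ TC
  c1 : ∀ d, ContinuousOn (G d) TC
  d0 : ∀ x ∈ TC, x ∉ range refTri → HasFDerivAt ξ (dl fun d => G d x) x
  d1 : ∀ d, ∀ x ∈ TT, HasFDerivAt (G d) (dl fun d' => Hs d d' x) x
  c2 : ∀ d d', ContinuousOn (Hs d d') TT
  b2 : ∀ d d', ∃ C, ∀ x ∈ TT, ‖Hs d d' x‖ ≤ C

lemma vert_notMem_TT {x : E2} (hx : x ∈ TT) : x ∉ range refTri := by
  rintro ⟨i, rfl⟩
  revert hx
  fin_cases i <;> simp [refTri, TT]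

lemma memLp_of_bdd {u : E2 → ℝ} (h : ContinuousOn u TT) (hb : ∃ C, ∀ x ∈ TT, ‖u x‖ ≤ C) :
    MemLp u 2 muT := by
  obtain ⟨C, hC⟩ := hb
  refine MemLp.of_bound (h.aestronglyMeasurable measurableSet_TT) C ?_
  filter_upwards [ae_restrict_mem measurableSet_TT] with x hx using hC x hx

lemma bdd_TC {u : E2 → ℝ} (h : ContinuousOn u TC) : ∃ C, ∀ x ∈ TT, ‖u x‖ ≤ C := by
  obtain ⟨C, hC⟩ := isCompact_TC.exists_bound_of_continuousOn h
  exact ⟨C, fun x hx => hC x (TT_sub_TC hx)⟩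

lemma memLp_TC {u : E2 → ℝ} (h : ContinuousOn u TC) : MemLp u 2 muT :=
  memLp_of_bdd (h.mono TT_sub_TC) (bdd_TC h)

lemma Good.memH2W {ξ : E2 → ℝ} {G : Fin 2 → E2 → ℝ} {Hs : Fin 2 → Fin 2 → E2 → ℝ}
    (h : Good ξ G Hs) : MemH2W (tri refTri) ξ G Hs := by
  have hξ := memLp_TC h.c0
  have hG := fun d => memLp_TC (h.c1 d)
  have hH := fun d d' => memLp_of_bdd (h.c2 d d') (h.b2 d d')
  refine ⟨?_, fun d => ⟨?_, ?_⟩, fun d d' => ⟨?_, ?_⟩⟩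
  · rw [tri_eq]; exact hξ
  · rw [tri_eq]; exact hG d
  · exact (faceTrace_of ξ G h.c0 (fun d => int_of_L2 (hG d))
      (fun x hx => h.d0 x (TT_sub_TC hx) (vert_notMem_TT hx))).isWeakD (int_of_L2 hξ)
      (fun d => int_of_L2 (hG d)) d
  · rw [tri_eq]; exact hH d d'
  · exact (faceTrace_of (G d) (Hs d) (h.c1 d) (fun d' => int_of_L2 (hH d d'))
      (h.d1 d)).isWeakD (int_of_L2 (hG d))
      (fun d' => int_of_L2 (hH d d')) d'

lemma tang_norm (i : Fin 3) : tangv refTri i 0 ^ 2 + tangv refTri i 1 ^ 2 = 1 := by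
  have h := (elen_pos i).ne'
  have h2 : elen refTri i ^ 2 = evec refTri i 0 ^ 2 + evec refTri i 1 ^ 2 := by
    rw [elen, EuclideanSpace.norm_sq_eq]; simp
  simp only [tangv, PiLp.smul_apply, smul_eq_mul]
  field_simp
  linarith

lemma norv_apply (i : Fin 3) : norv refTri i 0 = tangv refTri i 1 ∧ norv refTri i 1 = - tangv refTri i 0 := by
  simp [norv]

lemma epar_not_vert (i : Fin 3) {t : ℝ} (ht : t ∈ Ioo (0:ℝ) 1) : epar refTri i t ∉ range refTri := by
  rintro ⟨j, hj⟩
  rw [epar_ref] at hj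
  obtain ⟨h0, h1⟩ := ht
  have a := congrArg (fun v : E2 => v 0) hj
  have b := congrArg (fun v : E2 => v 1) hj
  fin_cases i <;> fin_cases j <;> simp [refTri] at a b <;> linarith

def Lifts (ξ : E2 → ℝ) (G : Fin 2 → E2 → ℝ) (f g : Fin 3 → ℝ → ℝ) : Prop :=
  ∀ i, ∀ t ∈ Ioo (0:ℝ) 1, f i t = ξ (epar refTri i t) ∧
    g i t = G 0 (epar refTri i t) * norv refTri i 0 + G 1 (epar refTri i t) * norv refTri i 1

lemma Good.traceW {ξ : E2 → ℝ} {G : Fin 2 → E2 → ℝ} {Hs : Fin 2 → Fin 2 → E2 → ℝ}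
    (h : Good ξ G Hs) {f g : Fin 3 → ℝ → ℝ} (hl : Lifts ξ G f g) :
    TraceW refTri ξ G Hs f g := by
  have hG := fun d => memLp_TC (h.c1 d)
  have hH := fun d d' => memLp_of_bdd (h.c2 d d') (h.b2 d d')
  constructor
  · exact (faceTrace_of ξ G h.c0 (fun d => int_of_L2 (hG d))
      (fun x hx => h.d0 x (TT_sub_TC hx) (vert_notMem_TT hx))).congr
      (fun j t ht => (hl j t ht).1.symm)
  · intro d
    refine (faceTrace_of (G d) (Hs d) (h.c1 d) (fun d' => int_of_L2 (hH d d'))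
      (h.d1 d)).congr (fun j t ht => ?_)
    have hf : HasDerivAt (f j) (dl (fun d => G d (epar refTri j t)) (evec refTri j)) t := by
      have h1 : HasDerivAt (epar refTri j) (evec refTri j) t := by
        have := ((hasDerivAt_id t).smul_const (evec refTri j)).const_add (refTri (j + 1))
        rw [one_smul] at this
        exact this
      have h2 := (h.d0 _ (epar_mem_TC j (Ioo_subset_Icc_self ht)) (epar_not_vert j ht)).comp_hasDerivAt t h1
      refine h2.congr_of_eventuallyEq ?_
      filter_upwards [Ioo_mem_nhds ht.1 ht.2] with s hs
      exact (hl j s hs).1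
    have hdw : derivWithin (f j) (Icc 0 1) t = dl (fun d => G d (epar refTri j t)) (evec refTri j) :=
      hf.hasDerivWithinAt.derivWithin (uniqueDiffOn_Icc zero_lt_one t (Ioo_subset_Icc_self ht))
    have hn := tang_norm j
    have he := (elen_pos j).ne'
    obtain ⟨n0, n1⟩ := norv_apply j
    have ev : ∀ c, evec refTri j c = elen refTri j * tangv refTri j c := by
      intro c; simp [tangv]; field_simp
    simp only [gfield, hdw, dl_apply, ev, (hl j t ht).2, PiLp.add_apply, PiLp.smul_apply, smul_eq_mul, n0, n1]
    fin_cases d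
    · simp only [Fin.zero_eta, Fin.isValue, n0]
      field_simp
      linear_combination (-G 0 (epar refTri j t)) * hn
    · simp only [Fin.mk_one, Fin.isValue, n1]
      field_simp
      linear_combination (-G 1 (epar refTri j t)) * hn


def GoodG (ξ : E2 → ℝ) (G : Fin 2 → E2 → ℝ) : Prop := ∃ Hs, Good ξ G Hs

lemma GoodG.congr {ξ ξ' : E2 → ℝ} {G G' : Fin 2 → E2 → ℝ} (h : GoodG ξ G)
    (e : ∀ x, ξ x = ξ' x) (e' : ∀ d x, G d x = G' d x) : GoodG ξ' G' := by
  have h1 : ξ' = ξ := by funext x; exact (e x).symm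
  have h2 : G' = G := by funext d x; exact (e' d x).symm
  rw [h1, h2]; exact h

lemma GoodG.const (c : ℝ) : GoodG (fun _ => c) (fun _ _ => 0) := by
  refine ⟨fun _ _ _ => 0, continuousOn_const, fun _ => continuousOn_const, ?_, ?_,
    fun _ _ => continuousOn_const, fun _ _ => ⟨0, by simp⟩⟩
  · intro x _ _
    refine (hasFDerivAt_const c x).congr_fderiv ?_
    ext v; simp [dl_apply]
  · intro d x _
    refine (hasFDerivAt_const (0:ℝ) x).congr_fderiv ?_
    ext v; simp [dl_apply]

lemma hasFDerivAt_lam (i : Fin 3) (x : E2) : HasFDerivAt (lam i) (dl (glam i)) x := by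
  have h0 : HasFDerivAt (fun x : E2 => x 0) (EuclideanSpace.proj 0 : E2 →L[ℝ] ℝ) x :=
    (EuclideanSpace.proj 0 : E2 →L[ℝ] ℝ).hasFDerivAt
  have h1 : HasFDerivAt (fun x : E2 => x 1) (EuclideanSpace.proj 1 : E2 →L[ℝ] ℝ) x :=
    (EuclideanSpace.proj 1 : E2 →L[ℝ] ℝ).hasFDerivAt
  fin_cases i
  · refine ((h0.const_sub 1).sub h1).congr_fderiv ?_
    ext v; simp [dl_apply, glam]; ring
  · refine h0.congr_fderiv ?_
    ext v; simp [dl_apply, glam]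
  · refine h1.congr_fderiv ?_
    ext v; simp [dl_apply, glam]

lemma cont_lam (i : Fin 3) : Continuous (lam i) :=
  continuous_iff_continuousAt.2 fun x => (hasFDerivAt_lam i x).continuousAt

lemma GoodG.lamG (i : Fin 3) : GoodG (lam i) (fun d _ => glam i d) := by
  refine ⟨fun _ _ _ => 0, (cont_lam i).continuousOn, fun _ => continuousOn_const, ?_, ?_,
    fun _ _ => continuousOn_const, fun _ _ => ⟨0, by simp⟩⟩
  · intro x _ _
    exact hasFDerivAt_lam i x
  · intro d x _
    refine (hasFDerivAt_const (glam i d) x).congr_fderiv ?_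
    ext v; simp [dl_apply]

lemma GoodG.add {ξ ξ' : E2 → ℝ} {G G' : Fin 2 → E2 → ℝ} (h : GoodG ξ G) (h' : GoodG ξ' G') :
    GoodG (fun x => ξ x + ξ' x) (fun d x => G d x + G' d x) := by
  obtain ⟨H, h⟩ := h
  obtain ⟨H', h'⟩ := h'
  refine ⟨fun d d' x => H d d' x + H' d d' x, h.c0.add h'.c0, fun d => (h.c1 d).add (h'.c1 d),
    ?_, ?_, fun d d' => (h.c2 d d').add (h'.c2 d d'), ?_⟩
  · intro x hx hv
    refine ((h.d0 x hx hv).add (h'.d0 x hx hv)).congr_fderiv ?_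
    ext v; simp [dl_apply]; ring
  · intro d x hx
    refine ((h.d1 d x hx).add (h'.d1 d x hx)).congr_fderiv ?_
    ext v; simp [dl_apply]; ring
  · intro d d'
    obtain ⟨C, hC⟩ := h.b2 d d'
    obtain ⟨C', hC'⟩ := h'.b2 d d'
    exact ⟨C + C', fun x hx => (norm_add_le _ _).trans (add_le_add (hC x hx) (hC' x hx))⟩

lemma bdd_mul' {u v : E2 → ℝ} (hu : ∃ C, ∀ x ∈ TT, ‖u x‖ ≤ C) (hv : ∃ C, ∀ x ∈ TT, ‖v x‖ ≤ C) :
    ∃ C, ∀ x ∈ TT, ‖u x * v x‖ ≤ C := by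
  obtain ⟨C, hC⟩ := hu
  obtain ⟨D, hD⟩ := hv
  refine ⟨C * D, fun x hx => ?_⟩
  rw [norm_mul]
  exact mul_le_mul (hC x hx) (hD x hx) (norm_nonneg _) ((norm_nonneg _).trans (hC x hx))

lemma bdd_add' {u v : E2 → ℝ} (hu : ∃ C, ∀ x ∈ TT, ‖u x‖ ≤ C) (hv : ∃ C, ∀ x ∈ TT, ‖v x‖ ≤ C) :
    ∃ C, ∀ x ∈ TT, ‖u x + v x‖ ≤ C := by
  obtain ⟨C, hC⟩ := hu
  obtain ⟨D, hD⟩ := hv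
  exact ⟨C + D, fun x hx => (norm_add_le _ _).trans (add_le_add (hC x hx) (hD x hx))⟩

lemma GoodG.mul {ξ ξ' : E2 → ℝ} {G G' : Fin 2 → E2 → ℝ} (h : GoodG ξ G) (h' : GoodG ξ' G') :
    GoodG (fun x => ξ x * ξ' x) (fun d x => ξ x * G' d x + ξ' x * G d x) := by
  obtain ⟨H, h⟩ := h
  obtain ⟨H', h'⟩ := h'
  have hT := TT_sub_TC
  refine ⟨fun d d' x => (ξ x * H' d d' x + G' d x * G d' x) + (ξ' x * H d d' x + G d x * G' d' x),
    h.c0.mul h'.c0, fun d => (h.c0.mul (h'.c1 d)).add (h'.c0.mul (h.c1 d)), ?_, ?_,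
    fun d d' => ?_, ?_⟩
  · intro x hx hv
    refine ((h.d0 x hx hv).mul (h'.d0 x hx hv)).congr_fderiv ?_
    ext v; simp [dl_apply]; ring
  · intro d x hx
    have a := h.d0 x (hT hx) (vert_notMem_TT hx)
    have b := h'.d0 x (hT hx) (vert_notMem_TT hx)
    refine ((a.mul (h'.d1 d x hx)).add (b.mul (h.d1 d x hx))).congr_fderiv ?_
    ext v; simp [dl_apply]; ring
  · have a := h.c0.mono hT
    have b := h'.c0.mono hT
    have c := fun d => (h.c1 d).mono hT
    have e := fun d => (h'.c1 d).mono hT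
    exact ((a.mul (h'.c2 d d')).add ((e d).mul (c d'))).add
      ((b.mul (h.c2 d d')).add ((c d).mul (e d')))
  · intro d d'
    have a := bdd_TC h.c0
    have b := bdd_TC h'.c0
    have c := fun d => bdd_TC (h.c1 d)
    have e := fun d => bdd_TC (h'.c1 d)
    exact bdd_add' (bdd_add' (bdd_mul' a (h'.b2 d d')) (bdd_mul' (e d) (c d')))
      (bdd_add' (bdd_mul' b (h.b2 d d')) (bdd_mul' (c d) (e d')))

lemma GoodG.poly {ξ : E2 → ℝ} {G : Fin 2 → E2 → ℝ} (h : GoodG ξ G) (Q : Polynomial ℝ) :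
    GoodG (fun x => Q.eval (ξ x)) (fun d x => Q.derivative.eval (ξ x) * G d x) := by
  induction Q using Polynomial.induction_on' with
  | add p q hp hq =>
    refine (hp.add hq).congr (fun x => by simp) (fun d x => ?_)
    simp; ring
  | monomial n a =>
    induction n with
    | zero => exact (GoodG.const a).congr (fun x => by simp) (fun d x => by simp)
    | succ n ih =>
      refine (ih.mul h).congr (fun x => ?_) (fun d x => ?_)
      · simp [pow_succ]; ring
      · simp [Polynomial.derivative_monomial]
        cases n with
        | zero => simp
        | succ n => simp [pow_succ]; ring

/-! the singular function -/

lemma lam_TC {x : E2} (hx : x ∈ TC) (i : Fin 3) : 0 ≤ lam i x := by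
  obtain ⟨h1, h2, h3⟩ := hx
  fin_cases i <;> simp [lam] <;> linarith

lemma lam_TT {x : E2} (hx : x ∈ TT) (i : Fin 3) : 0 < lam i x := by
  obtain ⟨h1, h2, h3⟩ := hx
  fin_cases i <;> simp [lam] <;> linarith

lemma lam_sum {x : E2} : lam 0 x + lam 1 x + lam 2 x = 1 := by
  simp [lam]
  ring

lemma lam_le {x : E2} (hx : x ∈ TC) {j k : Fin 3} (h : j ≠ k) : lam j x ≤ 1 - lam k x := by
  have h0 := lam_TC hx 0
  have h1 := lam_TC hx 1
  have h2 := lam_TC hx 2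
  have := lam_sum (x := x)
  fin_cases j <;> fin_cases k <;> simp at h ⊢ <;> linarith

lemma lam_one {x : E2} (hx : x ∈ TC) (hv : x ∉ range refTri) (k : Fin 3) : 0 < 1 - lam k x := by
  obtain ⟨h1, h2, h3⟩ := hx
  by_contra hc
  apply hv
  refine ⟨k, ?_⟩
  fin_cases k
  · simp [lam] at hc
    ext d; fin_cases d <;> simp [refTri] <;> linarith
  · simp [lam] at hc
    ext d; fin_cases d <;> simp [refTri] <;> linarith
  · simp [lam] at hc
    ext d; fin_cases d <;> simp [refTri] <;> linarith

lemma cont_ratio {j k : Fin 3} (hjk : j ≠ k) (m : ℕ) (hm : m ≠ 0) :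
    ContinuousOn (fun x => lam j x ^ (m + 1) / (1 - lam k x) ^ m) TC := by
  intro x hx
  have hj := cont_lam j
  have hk := cont_lam k
  by_cases hs : 1 - lam k x = 0
  · have hb : lam j x = 0 := le_antisymm (by rw [← hs]; exact lam_le hx hjk) (lam_TC hx j)
    have h0 : Filter.Tendsto (fun y => 1 - lam k y) (nhdsWithin x TC) (nhds 0) := by
      have : Continuous fun y => 1 - lam k y := by fun_prop
      have h := this.tendsto x
      rw [hs] at h
      exact h.mono_left nhdsWithin_le_nhds
    unfold ContinuousWithinAt
    beta_reduce
    rw [hb, zero_pow (by omega), zero_div]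
    refine squeeze_zero' ?_ ?_ h0
    · filter_upwards [self_mem_nhdsWithin] with y hy
      have a := lam_TC hy j
      have b := a.trans (lam_le hy hjk)
      positivity
    · filter_upwards [self_mem_nhdsWithin] with y hy
      have a := lam_TC hy j
      have b := lam_le hy hjk
      have c := a.trans b
      rcases c.eq_or_lt with c | c
      · rw [← c]; simp [hm]
      · rw [div_le_iff₀ (by positivity), ← pow_succ']
        exact pow_le_pow_left₀ a b _
  · apply ContinuousAt.continuousWithinAt
    have hs' : (1 - lam k x) ^ m ≠ 0 := pow_ne_zero _ hs
    exact ContinuousAt.div (by fun_prop) (by fun_prop) hs'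

lemma bdd_ratio {j k : Fin 3} (hjk : j ≠ k) (m : ℕ) (c : ℝ) :
    ∃ C, ∀ x ∈ TT, ‖c * (lam j x ^ m / (1 - lam k x) ^ m)‖ ≤ C := by
  refine ⟨|c|, fun x hx => ?_⟩
  have a := lam_TT hx j
  have b := lam_le (TT_sub_TC hx) hjk
  rw [norm_mul, ← div_pow, norm_pow]
  have : ‖lam j x / (1 - lam k x)‖ ≤ 1 := by
    rw [Real.norm_eq_abs, abs_of_nonneg (by apply div_nonneg <;> linarith)]
    exact div_le_one_of_le₀ b (by linarith)
  calc ‖c‖ * _ ≤ |c| * 1 := mul_le_mul_of_nonneg_left (pow_le_one₀ (norm_nonneg _) this) (abs_nonneg c)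
    _ = |c| := mul_one _

lemma deriv_ratio {j k : Fin 3} (n m : ℕ) {x : E2} (hs : 1 - lam k x ≠ 0) :
    HasFDerivAt (fun x => lam j x ^ (n + 1) / (1 - lam k x) ^ m)
      (dl fun d => ((n + 1 : ℝ) * lam j x ^ n / (1 - lam k x) ^ m) * glam j d
        + (m * lam j x ^ (n + 1) / (1 - lam k x) ^ (m + 1)) * glam k d) x := by
  have hq : HasDerivAt (fun t : ℝ => t ^ (n + 1)) ((n + 1 : ℝ) * lam j x ^ n) (lam j x) := by
    simpa using hasDerivAt_pow (n + 1) (lam j x)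
  have hr : HasDerivAt (fun t : ℝ => ((1 - t) ^ m)⁻¹) (m / (1 - lam k x) ^ (m + 1)) (lam k x) := by
    have h1 : HasDerivAt (fun t : ℝ => 1 - t) (-1) (lam k x) := by
      simpa using (hasDerivAt_id (lam k x)).const_sub 1
    have h2 := (h1.pow m).inv (pow_ne_zero _ hs)
    refine h2.congr_deriv ?_
    cases m with
    | zero => simp
    | succ m =>
      simp only [Nat.add_sub_cancel]
      simp only [Pi.pow_apply]
      field_simp
      ring
  have h1 := hq.comp_hasFDerivAt x (hasFDerivAt_lam j x)
  have h2 := hr.comp_hasFDerivAt x (hasFDerivAt_lam k x)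
  refine ((h1.mul h2).congr_fderiv ?_).congr_of_eventuallyEq ?_
  · ext v
    simp [dl_apply]
    field_simp
    ring
  · exact Filter.Eventually.of_forall fun y => by simp [div_eq_mul_inv]

lemma GoodG.sing {j k : Fin 3} (hjk : j ≠ k) : GoodG (fun x => lam j x ^ 3 / (1 - lam k x))
    (fun d x => 3 * lam j x ^ 2 / (1 - lam k x) * glam j d
      + lam j x ^ 3 / (1 - lam k x) ^ 2 * glam k d) := by
  have r1 := cont_ratio hjk 1 one_ne_zero
  have r2 := cont_ratio hjk 2 two_ne_zero
  have hj := (cont_lam j).continuousOn (s := TC)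
  have hpos : ∀ x ∈ TT, 1 - lam k x ≠ 0 := fun x hx =>
    (lt_of_lt_of_le (lam_TT hx j) (lam_le (TT_sub_TC hx) hjk)).ne'
  refine ⟨fun d d' x => (6 * glam j d * glam j d') * (lam j x ^ 1 / (1 - lam k x) ^ 1)
      + (3 * (glam j d * glam k d' + glam k d * glam j d')) * (lam j x ^ 2 / (1 - lam k x) ^ 2)
      + (2 * glam k d * glam k d') * (lam j x ^ 3 / (1 - lam k x) ^ 3), ?_, ?_, ?_, ?_, ?_, ?_⟩
  · refine (hj.mul r1).congr fun x _ => ?_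
    simp; ring
  · intro d
    refine ((r1.const_mul (3 * glam j d)).add (r2.const_mul (glam k d))).congr fun x _ => ?_
    simp; ring
  · intro x hx hv
    have hs := (lam_one hx hv k).ne'
    have := deriv_ratio (j := j) 2 1 hs
    refine (this.congr_fderiv ?_).congr_of_eventuallyEq ?_
    · ext v
      simp [dl_apply]
      norm_num
    · exact Filter.Eventually.of_forall fun y => by simp
  · intro d x hx
    have hs := hpos x hx
    have h1 := (deriv_ratio (j := j) 1 1 hs).const_mul (3 * glam j d)
    have h2 := (deriv_ratio (j := j) 2 2 hs).const_mul (glam k d)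
    refine ((h1.add h2).congr_fderiv ?_).congr_of_eventuallyEq ?_
    · ext v
      simp [dl_apply]
      field_simp
      ring
    · exact Filter.Eventually.of_forall fun y => by simp; ring
  · intro d d'
    have hk := cont_lam k
    have hj := cont_lam j
    have c : ∀ m : ℕ, ContinuousOn (fun x => lam j x ^ m / (1 - lam k x) ^ m) TT := fun m =>
      ContinuousOn.div (by fun_prop) (by fun_prop) (fun x hx => pow_ne_zero _ (hpos x hx))
    exact (((c 1).const_mul _).add ((c 2).const_mul _)).add ((c 3).const_mul _)
  · intro d d'
    exact bdd_add' (bdd_add' (bdd_ratio hjk 1 _) (bdd_ratio hjk 2 _)) (bdd_ratio hjk 3 _)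


/-! ### Lifting of boundary data -/

lemma lam_epar (j k : Fin 3) (t : ℝ) :
    lam k (epar refTri j t) = (![![0, 1 - t, t], ![t, 0, 1 - t], ![1 - t, t, 0]] j : Fin 3 → ℝ) k := by
  rw [epar_ref]
  fin_cases j <;> fin_cases k <;> simp [lam]

lemma lam_epar0 (j : Fin 3) (t : ℝ) : lam j (epar refTri j t) = 0 := by
  rw [lam_epar]; fin_cases j <;> simp
lemma lam_epar1 (j : Fin 3) (t : ℝ) : lam (j + 1) (epar refTri j t) = 1 - t := by
  rw [lam_epar]; fin_cases j <;> simp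
lemma lam_epar2 (j : Fin 3) (t : ℝ) : lam (j + 2) (epar refTri j t) = t := by
  rw [lam_epar]; fin_cases j <;> simp

/-- normal derivative of the barycentric coordinate `j` on edge `i` -/
def gn (i j : Fin 3) : ℝ := glam j 0 * norv refTri i 0 + glam j 1 * norv refTri i 1

lemma gn_self (i : Fin 3) : gn i i ≠ 0 := by
  have h := elen_pos i
  have h0 := elen_norv i 0
  have h1 := elen_norv i 1
  intro hc
  have : elen refTri i * gn i i = 0 := by rw [hc, mul_zero]
  have e : elen refTri i * gn i i = glam i 0 * nn i 0 + glam i 1 * nn i 1 := by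
    rw [← h0, ← h1, gn]; ring
  rw [e] at this
  revert this
  fin_cases i <;> simp [glam, nn]

def Liftable (f g : Fin 3 → ℝ → ℝ) : Prop := ∃ ξ G, GoodG ξ G ∧ Lifts ξ G f g

lemma Liftable.congr {f g f' g' : Fin 3 → ℝ → ℝ} (h : Liftable f g)
    (hf : ∀ i, ∀ t ∈ Ioo (0:ℝ) 1, f i t = f' i t) (hg : ∀ i, ∀ t ∈ Ioo (0:ℝ) 1, g i t = g' i t) :
    Liftable f' g' := by
  obtain ⟨ξ, G, h1, h2⟩ := h
  exact ⟨ξ, G, h1, fun i t ht => ⟨by rw [← hf i t ht]; exact (h2 i t ht).1,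
    by rw [← hg i t ht]; exact (h2 i t ht).2⟩⟩

lemma Liftable.add {f g f' g' : Fin 3 → ℝ → ℝ} (h : Liftable f g) (h' : Liftable f' g') :
    Liftable (fun i t => f i t + f' i t) (fun i t => g i t + g' i t) := by
  obtain ⟨ξ, G, h1, h2⟩ := h
  obtain ⟨ξ', G', h1', h2'⟩ := h'
  refine ⟨_, _, h1.add h1', fun i t ht => ⟨?_, ?_⟩⟩
  · beta_reduce; rw [(h2 i t ht).1, (h2' i t ht).1]
  · beta_reduce; rw [(h2 i t ht).2, (h2' i t ht).2]; ring

lemma liftA (i : Fin 3) (F : Polynomial ℝ) : ∃ h : Polynomial ℝ,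
    Liftable (fun j t => if j = i then t ^ 2 * (1 - t) ^ 2 * F.eval t else 0)
      (fun j t => if j = i then t * (1 - t) * h.eval t else 0) := by
  refine ⟨Polynomial.C (2 * gn i (i + 1)) * Polynomial.X * F +
    Polynomial.C (gn i (i + 2)) * (2 * F + Polynomial.X * F.derivative) * (1 - Polynomial.X), _, _,
    ((GoodG.lamG (i + 1)).poly (Polynomial.X ^ 2)).mul
      ((GoodG.lamG (i + 2)).poly (Polynomial.X ^ 2 * F)), ?_⟩
  intro j t ht
  by_cases hj : j = i
  · subst hj
    simp only [if_true, lam_epar1, lam_epar2]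
    constructor
    · simp; ring
    · simp [gn]; ring
  · have : lam (i + 1) (epar refTri j t) = 0 ∨ lam (i + 2) (epar refTri j t) = 0 := by
      rw [lam_epar, lam_epar]
      fin_cases i <;> fin_cases j <;> simp at hj ⊢
    simp only [if_neg hj]
    rcases this with h | h <;> simp [h]

lemma liftB1 (i : Fin 3) (h : Polynomial ℝ) :
    Liftable (fun _ _ => 0) (fun j t => if j = i then t ^ 2 * (1 - t) * h.eval t * gn i i else 0) := by
  have hab : i + 1 ≠ i + 2 := by fin_cases i <;> simp
  refine ⟨_, _, (((GoodG.lamG (i + 1)).poly (Polynomial.X ^ 2)).add ((GoodG.const (-1)).mul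
    (GoodG.sing hab))).mul ((GoodG.lamG (i + 2)).poly (Polynomial.X ^ 2 * h)), ?_⟩
  intro j t ht
  have h1 : (1 - t) ≠ 0 := by linarith [ht.2]
  have h0 : t ≠ 0 := by linarith [ht.1]
  by_cases hj : j = i
  · subst hj
    have hs : ∀ d, glam j d = - glam (j + 1) d - glam (j + 2) d := by
      intro d; fin_cases j <;> fin_cases d <;> simp [glam]
    simp only [if_true, lam_epar1, lam_epar2, gn, hs]
    constructor
    · simp; left; field_simp; ring
    · simp; field_simp; ring
  · have : lam (i + 1) (epar refTri j t) = 0 ∨ lam (i + 2) (epar refTri j t) = 0 := by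
      rw [lam_epar, lam_epar]
      fin_cases i <;> fin_cases j <;> simp at hj ⊢
    simp only [if_neg hj]
    rcases this with h | h <;> simp [h]

lemma liftB2 (i : Fin 3) (h : Polynomial ℝ) :
    Liftable (fun _ _ => 0) (fun j t => if j = i then t * (1 - t) ^ 2 * h.eval t * gn i i else 0) := by
  have hab : i + 2 ≠ i + 1 := by fin_cases i <;> simp
  refine ⟨_, _, ((((GoodG.lamG (i + 2)).poly (Polynomial.X ^ 2)).add ((GoodG.const (-1)).mul
    (GoodG.sing hab))).mul ((GoodG.lamG (i + 1)).poly (Polynomial.X ^ 2))).mul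
    ((GoodG.lamG (i + 2)).poly h), ?_⟩
  intro j t ht
  have h1 : (1 - t) ≠ 0 := by linarith [ht.2]
  have h0 : t ≠ 0 := by linarith [ht.1]
  by_cases hj : j = i
  · subst hj
    have hs : ∀ d, glam j d = - glam (j + 1) d - glam (j + 2) d := by
      intro d; fin_cases j <;> fin_cases d <;> simp [glam]
    simp only [if_true, lam_epar1, lam_epar2, gn, hs]
    constructor
    · simp; left; left; field_simp; ring
    · simp; field_simp; ring
  · have : lam (i + 1) (epar refTri j t) = 0 ∨ lam (i + 2) (epar refTri j t) = 0 := by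
      rw [lam_epar, lam_epar]
      fin_cases i <;> fin_cases j <;> simp at hj ⊢
    simp only [if_neg hj]
    rcases this with h | h <;> simp [h]

lemma liftB (i : Fin 3) (h : Polynomial ℝ) :
    Liftable (fun _ _ => 0) (fun j t => if j = i then t * (1 - t) * h.eval t else 0) := by
  have hc := gn_self i
  refine ((liftB1 i (Polynomial.C (gn i i)⁻¹ * h)).add (liftB2 i (Polynomial.C (gn i i)⁻¹ * h))).congr
    (fun j t _ => by simp) (fun j t _ => ?_)
  by_cases hj : j = i
  · simp [hj]; field_simp; ring
  · simp [hj]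

lemma liftAB (i : Fin 3) (F h : Polynomial ℝ) : 
    Liftable (fun j t => if j = i then t ^ 2 * (1 - t) ^ 2 * F.eval t else 0)
      (fun j t => if j = i then t * (1 - t) * h.eval t else 0) := by
  obtain ⟨h', h1⟩ := liftA i F
  refine (h1.add (liftB i (h - h'))).congr (fun j t _ => by simp) (fun j t _ => ?_)
  by_cases hj : j = i
  · simp [hj]; ring
  · simp [hj]

lemma lift_bub (F h : Fin 3 → Polynomial ℝ) :
    Liftable (fun j t => t ^ 2 * (1 - t) ^ 2 * (F j).eval t)
      (fun j t => t * (1 - t) * (h j).eval t) := by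
  refine (((liftAB 0 (F 0) (h 0)).add (liftAB 1 (F 1) (h 1))).add (liftAB 2 (F 2) (h 2))).congr
    (fun j t _ => ?_) (fun j t _ => ?_)
  · fin_cases j <;> simp
  · fin_cases j <;> simp

/-- edge Hermite data -/
def hf0 (vv : Fin 3 → ℝ) (w : Fin 3 → E2) (i : Fin 3) (t : ℝ) : ℝ :=
  (1 - t) ^ 2 * ((1 + 2 * t) * vv (i + 1) + t * dl (w (i + 1)) (evec refTri i))
    + t ^ 2 * ((3 - 2 * t) * vv (i + 2) - (1 - t) * dl (w (i + 2)) (evec refTri i))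

def hg0 (w : Fin 3 → E2) (i : Fin 3) (t : ℝ) : ℝ :=
  (1 - t) * dl (w (i + 1)) (norv refTri i) + t * dl (w (i + 2)) (norv refTri i)

/-- one vertex of the cubic interpolant -/
lemma good_vert (v : ℝ) (w : E2) (i : Fin 3) : GoodG
    (fun x => lam i x ^ 2 * ((3 - 2 * lam i x) * v + w 0 * (x 0 - refTri i 0) + w 1 * (x 1 - refTri i 1)))
    (fun d x => 2 * lam i x * ((3 - 2 * lam i x) * v + w 0 * (x 0 - refTri i 0) + w 1 * (x 1 - refTri i 1))
      * glam i d + lam i x ^ 2 * (- 2 * v * glam i d + w d)) := by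
  have h1 := (GoodG.lamG i).poly (Polynomial.X ^ 2)
  have h2 := (GoodG.lamG i).poly (Polynomial.C v * (3 - 2 * Polynomial.X))
  have h3 := (GoodG.lamG 1).poly (Polynomial.C (w 0) * (Polynomial.X - Polynomial.C (refTri i 0)))
  have h4 := (GoodG.lamG 2).poly (Polynomial.C (w 1) * (Polynomial.X - Polynomial.C (refTri i 1)))
  refine (h1.mul ((h2.add h3).add h4)).congr (fun x => ?_) (fun d x => ?_)
  · have e1 : lam 1 x = x 0 := by simp [lam]
    have e2 : lam 2 x = x 1 := by simp [lam]
    simp only [Polynomial.eval_pow, Polynomial.eval_X, Polynomial.eval_mul, Polynomial.eval_C,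
      Polynomial.eval_sub, Polynomial.eval_ofNat, e1, e2]
    ring
  · fin_cases d <;> simp [lam, glam] <;> ring

lemma lift_herm (vv : Fin 3 → ℝ) (w : Fin 3 → E2) : ∃ c : Fin 3 → ℝ,
    Liftable (hf0 vv w) (fun i t => hg0 w i t + t * (1 - t) * c i) := by
  refine ⟨fun i => 2 * (3 * vv (i + 1) + dl (w (i + 1)) (evec refTri i)) * gn i (i + 1)
    + 2 * (3 * vv (i + 2) - dl (w (i + 2)) (evec refTri i)) * gn i (i + 2)
    - dl (w (i + 1)) (norv refTri i) - dl (w (i + 2)) (norv refTri i), _, _,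
    ((good_vert (vv 0) (w 0) 0).add (good_vert (vv 1) (w 1) 1)).add (good_vert (vv 2) (w 2) 2), ?_⟩
  intro i t ht
  constructor
  · simp only [hf0, dl_apply, evec_ref, lam_epar]
    simp only [epar_ref]
    fin_cases i <;> simp [refTri] <;> ring
  · simp only [hg0, dl_apply, gn, evec_ref, lam_epar]
    simp only [epar_ref]
    generalize norv refTri i = n
    fin_cases i <;> simp [refTri, glam] <;> ring

lemma lift_all (vv : Fin 3 → ℝ) (w : Fin 3 → E2) (F h : Fin 3 → Polynomial ℝ) :
    Liftable (fun i t => hf0 vv w i t + t ^ 2 * (1 - t) ^ 2 * (F i).eval t)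
      (fun i t => hg0 w i t + t * (1 - t) * (h i).eval t) := by
  obtain ⟨c, hc⟩ := lift_herm vv w
  refine (hc.add (lift_bub F (fun i => h i - Polynomial.C (c i)))).congr (fun _ _ _ => rfl)
    (fun i t _ => ?_)
  simp; ring


/-! ### One dimensional unisolvence -/

lemma int_Ioo_cont {f : ℝ → ℝ} (hf : Continuous f) :
    Integrable f (volume.restrict (Ioo (0:ℝ) 1)) :=
  (hf.integrableOn_Icc (a := 0) (b := 1)).mono_set Ioo_subset_Icc_self

lemma wt_zero {ω : ℝ → ℝ} (hω : Continuous ω) (hp : ∀ t ∈ Ioo (0:ℝ) 1, 0 < ω t) (Q : Polynomial ℝ)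
    (h : ∫ t in Ioo (0:ℝ) 1, ω t * Q.eval t ^ 2 = 0) : Q = 0 := by
  have hc : Continuous fun t => ω t * Q.eval t ^ 2 := by fun_prop
  have h0 : 0 ≤ᵐ[volume.restrict (Ioo (0:ℝ) 1)] fun t => ω t * Q.eval t ^ 2 := by
    filter_upwards [ae_restrict_mem measurableSet_Ioo] with t ht
    exact mul_nonneg (hp t ht).le (sq_nonneg _)
  have h1 := (integral_eq_zero_iff_of_nonneg_ae h0 (int_Ioo_cont hc)).1 h
  have h2 := Measure.eqOn_open_of_ae_eq h1 isOpen_Ioo hc.continuousOn continuousOn_const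
  refine Polynomial.eq_zero_of_infinite_isRoot Q ((Ioo_infinite (zero_lt_one (α := ℝ))).mono ?_)
  intro t ht
  have := h2 ht
  simp only [Pi.zero_apply, mul_eq_zero, (hp t ht).ne', false_or] at this
  simpa using this

lemma unis_uniq {ω : ℝ → ℝ} (hω : Continuous ω) (hp : ∀ t ∈ Ioo (0:ℝ) 1, 0 < ω t) (n : ℕ)
    (Q : Polynomial ℝ) (hQ : ∀ m, n ≤ m → Q.coeff m = 0)
    (h : ∀ m : Fin n, ∫ t in Ioo (0:ℝ) 1, ω t * Q.eval t * t ^ (m : ℕ) = 0) : Q = 0 := by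
  apply wt_zero hω hp
  by_cases h0 : Q = 0
  · simp [h0]
  have hd : Q.natDegree < n := by
    by_contra hc
    exact h0 (Polynomial.leadingCoeff_eq_zero.1 (hQ _ (not_lt.1 hc)))
  have e : ∀ t, ω t * Q.eval t ^ 2 = ∑ m ∈ Finset.range n, Q.coeff m * (ω t * Q.eval t * t ^ m) := by
    intro t
    rw [sq]
    nth_rewrite 2 [Polynomial.eval_eq_sum_range' hd]
    rw [← mul_assoc, Finset.mul_sum]
    exact Finset.sum_congr rfl fun m _ => by ring
  simp_rw [e]
  rw [integral_finsetSum _ (fun m _ => int_Ioo_cont (by fun_prop))]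
  refine Finset.sum_eq_zero fun m hm => ?_
  rw [integral_const_mul, h ⟨m, Finset.mem_range.1 hm⟩, mul_zero]

lemma unis_ex {ω : ℝ → ℝ} (hω : Continuous ω) (hp : ∀ t ∈ Ioo (0:ℝ) 1, 0 < ω t) (n : ℕ)
    (b : Fin n → ℝ) : ∃ Q : Polynomial ℝ, (∀ m, n ≤ m → Q.coeff m = 0) ∧
      ∀ m : Fin n, ∫ t in Ioo (0:ℝ) 1, ω t * Q.eval t * t ^ (m : ℕ) = b m := by
  let P : (Fin n → ℝ) → Polynomial ℝ := fun c => ∑ j : Fin n, Polynomial.C (c j) * Polynomial.X ^ (j : ℕ)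
  have hco : ∀ c m, n ≤ m → (P c).coeff m = 0 := by
    intro c m hm
    simp only [P, Polynomial.finsetSum_coeff, Polynomial.coeff_C_mul_X_pow]
    exact Finset.sum_eq_zero fun j _ => if_neg (by have := j.2; omega)
  let M : Matrix (Fin n) (Fin n) ℝ := fun m j => ∫ t in Ioo (0:ℝ) 1, ω t * t ^ (j : ℕ) * t ^ (m : ℕ)
  have hM : ∀ c m, M.mulVec c m = ∫ t in Ioo (0:ℝ) 1, ω t * (P c).eval t * t ^ (m : ℕ) := by
    intro c m
    have : ∀ t, ω t * (P c).eval t * t ^ (m : ℕ) = ∑ j : Fin n, c j * (ω t * t ^ (j : ℕ) * t ^ (m : ℕ)) := by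
      intro t
      simp only [P, Polynomial.eval_finsetSum, Polynomial.eval_mul, Polynomial.eval_C,
        Polynomial.eval_pow, Polynomial.eval_X, Finset.mul_sum, Finset.sum_mul]
      exact Finset.sum_congr rfl fun m _ => by ring
    simp_rw [this]
    rw [integral_finsetSum _ (fun m _ => int_Ioo_cont (by fun_prop))]
    simp only [Matrix.mulVec, dotProduct, M]
    exact Finset.sum_congr rfl fun j _ => by rw [integral_const_mul, mul_comm]
  have hinj : Function.Injective (Matrix.toLin' M) := by
    rw [injective_iff_map_eq_zero]
    intro c hc
    have : P c = 0 := unis_uniq hω hp n _ (hco c) fun m => by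
      rw [← hM]; exact congrFun hc m
    funext j
    have h2 : (P c).coeff j = c j := by
      simp only [P, Polynomial.finsetSum_coeff, Polynomial.coeff_C_mul_X_pow]
      rw [Finset.sum_eq_single j]
      · simp
      · intro i _ hij
        exact if_neg (fun h => hij (Fin.ext h.symm))
      · simp
    rw [← h2, this]; simp
  obtain ⟨c, hc⟩ := LinearMap.injective_iff_surjective.1 hinj b
  exact ⟨P c, hco c, fun m => by rw [← hM, ← hc]; rfl⟩


lemma forall_vert (P : Fin 3 → Fin 3 → ℝ → Prop) :
    (∀ i j : Fin 3, j ≠ i → P i j (tau i j)) ↔ ∀ j, P (j + 1) j 0 ∧ P (j + 2) j 1 := by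
  have t0 : ∀ j : Fin 3, tau (j + 1) j = 0 := fun j => by simp [tau]
  have t1 : ∀ j : Fin 3, tau (j + 2) j = 1 := fun j => by fin_cases j <;> simp [tau]
  constructor
  · intro h j
    have h1 := h (j + 1) j (by fin_cases j <;> simp)
    have h2 := h (j + 2) j (by fin_cases j <;> simp)
    rw [t0] at h1; rw [t1] at h2
    exact ⟨h1, h2⟩
  · intro h i j hij
    have : i = j + 1 ∨ i = j + 2 := by
      revert hij; fin_cases i <;> fin_cases j <;> simp
    rcases this with rfl | rfl
    · rw [t0]; exact (h j).1
    · rw [t1]; exact (h j).2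

lemma dw_poly (Q : Polynomial ℝ) {t : ℝ} (ht : t ∈ Icc (0:ℝ) 1) :
    derivWithin (fun t => Q.eval t) (Icc 0 1) t = Q.derivative.eval t :=
  (Q.hasDerivAt t).hasDerivWithinAt.derivWithin (uniqueDiffOn_Icc zero_lt_one t ht)

lemma dvd_sq {D : Polynomial ℝ} {a : ℝ} (h : D.eval a = 0) (h' : D.derivative.eval a = 0) :
    (Polynomial.X - Polynomial.C a) ^ 2 ∣ D := by
  obtain ⟨E, rfl⟩ := Polynomial.dvd_iff_isRoot.2 h
  have : E.eval a = 0 := by simpa using h'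
  obtain ⟨E', rfl⟩ := Polynomial.dvd_iff_isRoot.2 this
  exact ⟨E', by ring⟩

lemma cop01 : IsCoprime (Polynomial.X - Polynomial.C (0:ℝ)) (Polynomial.X - Polynomial.C 1) :=
  Polynomial.isCoprime_X_sub_C_of_isUnit_sub (by simp)

lemma coeff_bub {W F : Polynomial ℝ} {m n : ℕ} (hW : W.natDegree ≤ m) (hF : ∀ j, n ≤ j → F.coeff j = 0)
    {l : ℕ} (hl : m + n ≤ l) : (W * F).coeff l = 0 := by
  by_cases h0 : F = 0
  · simp [h0]
  have hd : F.natDegree < n := by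
    by_contra hc
    exact h0 (Polynomial.leadingCoeff_eq_zero.1 (hF _ (not_lt.1 hc)))
  apply Polynomial.coeff_eq_zero_of_natDegree_lt
  have := Polynomial.natDegree_mul_le (p := W) (q := F)
  omega

lemma coeff_unbub {W F : Polynomial ℝ} {m k : ℕ} (hW : W.Monic) (hm : W.natDegree = m)
    (hF : ∀ j, k < j → (W * F).coeff j = 0) {l : ℕ} (hl : k < m + l) : F.coeff l = 0 := by
  by_contra hc
  have h0 : F ≠ 0 := by rintro rfl; simp at hc
  have h1 : l ≤ F.natDegree := Polynomial.le_natDegree_of_ne_zero hc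
  have h2 : (W * F).natDegree = m + F.natDegree := by rw [hW.natDegree_mul' h0, hm]
  have h3 := hF (m + F.natDegree) (by omega)
  rw [← h2] at h3
  have := Polynomial.leadingCoeff_eq_zero.1 h3
  exact mul_ne_zero hW.ne_zero h0 this

lemma herm_uniq {k : ℕ} (hk : 3 ≤ k) {f f' : ℝ → ℝ} (h : IsPolyDegLe k f) (h' : IsPolyDegLe k f')
    (e0 : f 0 = f' 0) (e1 : f 1 = f' 1) (d0 : derivWithin f (Icc 0 1) 0 = derivWithin f' (Icc 0 1) 0)
    (d1 : derivWithin f (Icc 0 1) 1 = derivWithin f' (Icc 0 1) 1)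
    (hm : ∀ m : Fin (k - 3), ∫ t in Ioo (0:ℝ) 1, f t * t ^ (m : ℕ) = ∫ t in Ioo (0:ℝ) 1, f' t * t ^ (m : ℕ)) :
    f = f' := by
  obtain ⟨Q, hQ, hf⟩ := h
  obtain ⟨Q', hQ', hf'⟩ := h'
  obtain rfl : f = fun t => Q.eval t := funext hf
  obtain rfl : f' = fun t => Q'.eval t := funext hf'
  rw [dw_poly _ (by simp), dw_poly _ (by simp)] at d0 d1
  beta_reduce at e0 e1 hm
  have v0 := dvd_sq (D := Q - Q') (a := 0) (by simp [e0]) (by simp [d0])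
  have v1 := dvd_sq (D := Q - Q') (a := 1) (by simp [e1]) (by simp [d1])
  obtain ⟨F, hF⟩ := (cop01.pow (m := 2) (n := 2)).mul_dvd v0 v1
  have : F = 0 := by
    refine unis_uniq (ω := fun t => t ^ 2 * (t - 1) ^ 2) (by fun_prop) (fun t ht => ?_) (k - 3) F
      (fun m hm => ?_) (fun m => ?_)
    · have := ht.1; have := sub_ne_zero.2 ht.2.ne; positivity
    · refine coeff_unbub (W := (Polynomial.X - Polynomial.C (0:ℝ)) ^ 2 * (Polynomial.X - Polynomial.C (1:ℝ)) ^ 2) (m := 4) (k := k)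
        (((Polynomial.monic_X_sub_C _).pow 2).mul ((Polynomial.monic_X_sub_C _).pow 2)) ?_ ?_ (by omega)
      · rw [((Polynomial.monic_X_sub_C _).pow 2).natDegree_mul ((Polynomial.monic_X_sub_C _).pow 2),
          (Polynomial.monic_X_sub_C _).natDegree_pow, (Polynomial.monic_X_sub_C _).natDegree_pow,
          Polynomial.natDegree_X_sub_C, Polynomial.natDegree_X_sub_C]
      · intro j hj
        rw [← hF, Polynomial.coeff_sub, hQ j (by exact_mod_cast hj), hQ' j (by exact_mod_cast hj), sub_zero]
    · have := hm m
      rw [← sub_eq_zero, ← integral_sub (int_Ioo_cont (by fun_prop)) (int_Ioo_cont (by fun_prop))] at this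
      refine Eq.trans ?_ this
      congr 1; funext t
      have := congrArg (Polynomial.eval t) hF
      simp at this
      rw [← sub_mul, this]
  rw [this, mul_zero, sub_eq_zero] at hF
  rw [hF]

lemma lin_uniq {k : ℕ} (hk : 3 ≤ k) {f f' : ℝ → ℝ} (h : IsPolyDegLe ((k : ℤ) - 1) f) (h' : IsPolyDegLe ((k : ℤ) - 1) f')
    (e0 : f 0 = f' 0) (e1 : f 1 = f' 1)
    (hm : ∀ m : Fin (k - 2), ∫ t in Ioo (0:ℝ) 1, f t * t ^ (m : ℕ) = ∫ t in Ioo (0:ℝ) 1, f' t * t ^ (m : ℕ)) :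
    f = f' := by
  obtain ⟨Q, hQ, hf⟩ := h
  obtain ⟨Q', hQ', hf'⟩ := h'
  obtain rfl : f = fun t => Q.eval t := funext hf
  obtain rfl : f' = fun t => Q'.eval t := funext hf'
  beta_reduce at e0 e1 hm
  have v0 := (Polynomial.dvd_iff_isRoot (p := Q - Q') (a := 0)).2 (by simp [e0])
  have v1 := (Polynomial.dvd_iff_isRoot (p := Q - Q') (a := 1)).2 (by simp [e1])
  obtain ⟨F, hF⟩ := cop01.mul_dvd v0 v1
  have : -F = 0 := by
    refine unis_uniq (ω := fun t => t * (1 - t)) (by fun_prop) (fun t ht => ?_) (k - 2) (-F)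
      (fun m hm => ?_) (fun m => ?_)
    · exact mul_pos ht.1 (by linarith [ht.2])
    · rw [Polynomial.coeff_neg, neg_eq_zero]
      refine coeff_unbub (W := (Polynomial.X - Polynomial.C (0:ℝ)) * (Polynomial.X - Polynomial.C (1:ℝ))) (m := 2) (k := k - 1)
        ((Polynomial.monic_X_sub_C _).mul (Polynomial.monic_X_sub_C _)) ?_ ?_ (by omega)
      · rw [(Polynomial.monic_X_sub_C _).natDegree_mul (Polynomial.monic_X_sub_C _),
          Polynomial.natDegree_X_sub_C, Polynomial.natDegree_X_sub_C]
      · intro j hj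
        rw [← hF, Polynomial.coeff_sub, hQ j (by omega), hQ' j (by omega), sub_zero]
    · have := hm m
      rw [← sub_eq_zero, ← integral_sub (int_Ioo_cont (by fun_prop)) (int_Ioo_cont (by fun_prop))] at this
      refine Eq.trans ?_ this
      congr 1; funext t
      have := congrArg (Polynomial.eval t) hF
      simp at this
      rw [← sub_mul, this]; simp; ring
  rw [neg_eq_zero.1 this, mul_zero, sub_eq_zero] at hF
  rw [hF]

lemma herm_ex {k : ℕ} (hk : 3 ≤ k) (a b c d : ℝ) (mf : Fin (k - 3) → ℝ) : ∃ (F : Polynomial ℝ) (f : ℝ → ℝ),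
    (∀ t, f t = (1 - t) ^ 2 * ((1 + 2 * t) * a + t * b) + t ^ 2 * ((3 - 2 * t) * c - (1 - t) * d)
      + t ^ 2 * (1 - t) ^ 2 * F.eval t) ∧
    IsPolyDegLe k f ∧ f 0 = a ∧ f 1 = c ∧ derivWithin f (Icc 0 1) 0 = b ∧ derivWithin f (Icc 0 1) 1 = d ∧
    ∀ m : Fin (k - 3), ∫ t in Ioo (0:ℝ) 1, f t * t ^ (m : ℕ) = mf m := by
  obtain ⟨F, hF, hm⟩ := unis_ex (ω := fun t => t ^ 2 * (1 - t) ^ 2) (by fun_prop) (fun t ht => by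
    have := ht.1; have := sub_ne_zero.2 ht.2.ne'; positivity) (k - 3)
    (fun m => mf m - ∫ t in Ioo (0:ℝ) 1, ((1 - t) ^ 2 * ((1 + 2 * t) * a + t * b) + t ^ 2 * ((3 - 2 * t) * c - (1 - t) * d)) * t ^ (m : ℕ))
  let C := fun x : ℝ => Polynomial.C x
  let X : Polynomial ℝ := Polynomial.X
  let W : Polynomial ℝ := (X ^ 2 * (1 - X) ^ 2)
  let Q0 : Polynomial ℝ := ((1 - X) ^ 2 * ((1 + 2 * X) * C a + X * C b) + X ^ 2 * ((3 - 2 * X) * C c - (1 - X) * C d))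
  let Q : Polynomial ℝ := Q0 + W * F
  have hW : W.natDegree ≤ 4 := by simp only [W, X]; compute_degree
  have hQ0 : Q0.natDegree ≤ 3 := by simp only [Q0, X, C]; compute_degree
  refine ⟨F, fun t => Q.eval t, ?_, ⟨Q, ?_, fun t => rfl⟩, ?_, ?_, ?_, ?_, ?_⟩
  · intro t
    simp only [Q, Q0, W, X, C, Polynomial.eval_add, Polynomial.eval_mul, Polynomial.eval_pow, Polynomial.eval_sub,
      Polynomial.eval_one, Polynomial.eval_X, Polynomial.eval_C, Polynomial.eval_ofNat]
  · intro n hn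
    have hn : k < n := by exact_mod_cast hn
    simp only [Q, Polynomial.coeff_add]
    rw [coeff_bub hW hF (by omega), Polynomial.coeff_eq_zero_of_natDegree_lt (by omega), add_zero]
  · simp [Q, Q0, W, X, C]
  · simp [Q, Q0, W, X, C]; ring
  · rw [dw_poly _ (by simp)]; simp [Q, Q0, W, X, C, Polynomial.derivative_pow]
  · rw [dw_poly _ (by simp)]; simp [Q, Q0, W, X, C, Polynomial.derivative_pow]; ring
  · intro m
    have e : ∀ t : ℝ, Q.eval t * t ^ (m : ℕ) = ((1 - t) ^ 2 * ((1 + 2 * t) * a + t * b) + t ^ 2 * ((3 - 2 * t) * c - (1 - t) * d)) * t ^ (m : ℕ) + t ^ 2 * (1 - t) ^ 2 * F.eval t * t ^ (m : ℕ) := by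
      intro t; simp [Q, Q0, W, X, C]; ring
    simp_rw [e]
    rw [integral_add (int_Ioo_cont (by fun_prop)) (int_Ioo_cont (by fun_prop)), hm m]
    ring

lemma lin_ex {k : ℕ} (hk : 3 ≤ k) (a c : ℝ) (mf : Fin (k - 2) → ℝ) : ∃ (F : Polynomial ℝ) (f : ℝ → ℝ),
    (∀ t, f t = (1 - t) * a + t * c + t * (1 - t) * F.eval t) ∧
    IsPolyDegLe ((k : ℤ) - 1) f ∧ f 0 = a ∧ f 1 = c ∧
    ∀ m : Fin (k - 2), ∫ t in Ioo (0:ℝ) 1, f t * t ^ (m : ℕ) = mf m := by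
  obtain ⟨F, hF, hm⟩ := unis_ex (ω := fun t => t * (1 - t)) (by fun_prop) (fun t ht => 
    mul_pos ht.1 (by linarith [ht.2])) (k - 2)
    (fun m => mf m - ∫ t in Ioo (0:ℝ) 1, ((1 - t) * a + t * c) * t ^ (m : ℕ))
  let C := fun x : ℝ => Polynomial.C x
  let X : Polynomial ℝ := Polynomial.X
  let W : Polynomial ℝ := (X * (1 - X))
  let Q0 : Polynomial ℝ := ((1 - X) * C a + X * C c)
  let Q : Polynomial ℝ := Q0 + W * F
  have hW : W.natDegree ≤ 2 := by simp only [W, X]; compute_degree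
  have hQ0 : Q0.natDegree ≤ 1 := by simp only [Q0, X, C]; compute_degree
  refine ⟨F, fun t => Q.eval t, ?_, ⟨Q, ?_, fun t => rfl⟩, ?_, ?_, ?_⟩
  · intro t; simp [Q, Q0, W, X, C]; ring
  · intro n hn
    have hn : k < n + 1 := by omega
    simp only [Q, Polynomial.coeff_add]
    rw [coeff_bub hW hF (by omega), Polynomial.coeff_eq_zero_of_natDegree_lt (by omega), add_zero]
  · simp [Q, Q0, W, X, C]
  · simp [Q, Q0, W, X, C]
  · intro m
    have e : ∀ t : ℝ, Q.eval t * t ^ (m : ℕ) = ((1 - t) * a + t * c) * t ^ (m : ℕ) + t * (1 - t) * F.eval t * t ^ (m : ℕ) := by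
      intro t; simp [Q, Q0, W, X, C]; ring
    simp_rw [e]
    rw [integral_add (int_Ioo_cont (by fun_prop)) (int_Ioo_cont (by fun_prop)), hm m]
    ring

/-- boundary degrees of freedom -/
def BD (k : ℕ) (vv : Fin 3 → ℝ) (w : Fin 3 → E2) (mf : Fin 3 → Fin (k - 3) → ℝ)
    (mg : Fin 3 → Fin (k - 2) → ℝ) (f g : Fin 3 → ℝ → ℝ) : Prop :=
  (∀ i, IsPolyDegLe (k : ℤ) (f i) ∧ IsPolyDegLe ((k : ℤ) - 1) (g i)) ∧
  (∀ i j : Fin 3, j ≠ i →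
    f j (tau i j) = vv i ∧
    derivWithin (f j) (Icc 0 1) (tau i j) = elen refTri j * ⟪w i, tangv refTri j⟫ ∧
    g j (tau i j) = ⟪w i, norv refTri j⟫) ∧
  (∀ i (m : Fin (k - 3)), ∫ t in Ioo (0:ℝ) 1, f i t * t ^ (m : ℕ) = mf i m) ∧
  (∀ i (m : Fin (k - 2)), ∫ t in Ioo (0:ℝ) 1, g i t * t ^ (m : ℕ) = mg i m)

lemma bd_uniq {k : ℕ} (hk : 3 ≤ k) {vv w mf mg f g f' g'} (h : BD k vv w mf mg f g)
    (h' : BD k vv w mf mg f' g') : f' = f ∧ g' = g := by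
  obtain ⟨p, v, m, m2⟩ := h
  obtain ⟨p', v', m', m2'⟩ := h'
  have v := (forall_vert fun i j t => f j t = vv i ∧
    derivWithin (f j) (Icc 0 1) t = elen refTri j * ⟪w i, tangv refTri j⟫ ∧
    g j t = ⟪w i, norv refTri j⟫).1 v
  have v' := (forall_vert fun i j t => f' j t = vv i ∧
    derivWithin (f' j) (Icc 0 1) t = elen refTri j * ⟪w i, tangv refTri j⟫ ∧
    g' j t = ⟪w i, norv refTri j⟫).1 v'
  beta_reduce at v v'
  constructor
  · funext j
    exact herm_uniq hk (p' j).1 (p j).1 (by rw [(v j).1.1, (v' j).1.1]) (by rw [(v j).2.1, (v' j).2.1])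
      (by rw [(v j).1.2.1, (v' j).1.2.1]) (by rw [(v j).2.2.1, (v' j).2.2.1]) (fun i => by rw [m', m])
  · funext j
    exact lin_uniq hk (p' j).2 (p j).2 (by rw [(v j).1.2.2, (v' j).1.2.2]) (by rw [(v j).2.2.2, (v' j).2.2.2])
      (fun i => by rw [m2', m2])

lemma inner_dl (w v : E2) : ⟪w, v⟫ = dl w v := by
  rw [dl_apply]; simp [PiLp.inner_apply]; ring

lemma elen_tang (w : E2) (j : Fin 3) : elen refTri j * ⟪w, tangv refTri j⟫ = dl w (evec refTri j) := by
  rw [tangv, real_inner_smul_right, inner_dl, ← mul_assoc, mul_inv_cancel₀ (elen_pos j).ne', one_mul]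

lemma bd_ex {k : ℕ} (hk : 3 ≤ k) (vv w mf mg) :
    ∃ f g, BD k vv w mf mg f g ∧ Liftable f g := by
  choose F f hf using fun i : Fin 3 => herm_ex hk (vv (i + 1)) (dl (w (i + 1)) (evec refTri i))
    (vv (i + 2)) (dl (w (i + 2)) (evec refTri i)) (mf i)
  choose h g hg using fun i : Fin 3 => lin_ex hk (dl (w (i + 1)) (norv refTri i))
     (dl (w (i + 2)) (norv refTri i)) (mg i)
  refine ⟨f, g, ⟨fun i => ⟨(hf i).2.1, (hg i).2.1⟩, ?_, fun i => (hf i).2.2.2.2.2.2, fun i => (hg i).2.2.2.2⟩,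
    (lift_all vv w F h).congr (fun i t _ => ((hf i).1 t).symm) (fun i t _ => ((hg i).1 t).symm)⟩
  refine (forall_vert fun i j t => f j t = vv i ∧
    derivWithin (f j) (Icc 0 1) t = elen refTri j * ⟪w i, tangv refTri j⟫ ∧
    g j t = ⟪w i, norv refTri j⟫).2 ?_
  intro j
  simp only [elen_tang]
  simp only [inner_dl]
  obtain ⟨-, -, a, b, c, d, -⟩ := hf j
  obtain ⟨-, -, a', b', -⟩ := hg j
  exact ⟨⟨a, c, a'⟩, ⟨b, d, b'⟩⟩

lemma BD.compat {k vv w mf mg f g} (h : BD k vv w mf mg f g) : Compat refTri f g := by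
  obtain ⟨p, v, m, m2⟩ := h
  exact ⟨fun i j l hj hl => by rw [(v i j hj).1, (v i l hl).1], w, fun i j hj => (v i j hj).2⟩

lemma dim_arith (k : ℕ) (hk : 3 ≤ k) :
    6 * (k - 1) + (k - 3) * (k - 2) / 2 = (k * k + 7 * k - 6) / 2 := by
  obtain ⟨n, rfl⟩ := Nat.exists_eq_add_of_le' hk
  have e1 : n + 3 - 3 = n := by omega
  have e2 : n + 3 - 2 = n + 1 := by omega
  have e3 : n + 3 - 1 = n + 2 := by omega
  rw [e1, e2, e3]
  obtain ⟨q, hq⟩ := (Nat.even_mul_succ_self n)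
  have : (n + 3) * (n + 3) + 7 * (n + 3) - 6 = n * (n + 1) + 12 * (n + 2) := by
    have : (n + 3) * (n + 3) + 7 * (n + 3) = n * (n + 1) + 12 * (n + 2) + 6 := by ring
    omega
  rw [this]; omega


/-! ### Mollification -/

def Pd (d : Fin 2) (φ : E2 → ℝ) : E2 → ℝ := fun y => fderiv ℝ φ y (stdb2 d)

lemma Pd_contDiff {φ : E2 → ℝ} (h : ContDiff ℝ (⊤ : ℕ∞) φ) (d : Fin 2) : ContDiff ℝ (⊤ : ℕ∞) (Pd d φ) := by
  have : ContDiff ℝ (⊤ : ℕ∞) (fderiv ℝ φ) := h.fderiv_right (by norm_cast)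
  exact this.clm_apply contDiff_const

lemma Pd_supp {φ : E2 → ℝ} (h : HasCompactSupport φ) (d : Fin 2) : HasCompactSupport (Pd d φ) :=
  supp_pd h _

lemma Pd_tsupp {φ : E2 → ℝ} (d : Fin 2) : tsupport (Pd d φ) ⊆ tsupport φ :=
  tsupport_fderiv_apply_subset ℝ _

def moll (ψ u : E2 → ℝ) (z : E2) : ℝ := ∫ y, u y * ψ (z - y)

lemma moll_eq (ψ u : E2 → ℝ) : moll ψ u = convolution u ψ (ContinuousLinearMap.mul ℝ ℝ) volume := by
  funext z; rfl

lemma moll_contDiff {ψ u : E2 → ℝ} (hψ : ContDiff ℝ (⊤ : ℕ∞) ψ) (hc : HasCompactSupport ψ)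
    (hu : Integrable u) : ContDiff ℝ (⊤ : ℕ∞) (moll ψ u) := by
  rw [moll_eq]
  exact hc.contDiff_convolution_right _ hu.locallyIntegrable hψ

lemma moll_pd {ψ u : E2 → ℝ} (hψ : ContDiff ℝ (⊤ : ℕ∞) ψ) (hc : HasCompactSupport ψ)
    (hu : Integrable u) (d : Fin 2) (z : E2) : Pd d (moll ψ u) z = ∫ y, u y * Pd d ψ (z - y) := by
  have h := hc.hasFDerivAt_convolution_right (ContinuousLinearMap.mul ℝ ℝ) (μ := volume)
    hu.locallyIntegrable (hψ.of_le (by norm_cast)) z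
  rw [← moll_eq] at h
  rw [Pd, h.fderiv, convolution, ContinuousLinearMap.integral_apply]
  · rfl
  · have := (hc.fderiv ℝ).convolutionExists_right ((ContinuousLinearMap.mul ℝ ℝ).precompR E2)
      (μ := volume) hu.locallyIntegrable (hψ.continuous_fderiv (by simp)) z
    exact this

/-- zero trace condition in integrated form -/
def W0 (u : E2 → ℝ) (Du : Fin 2 → E2 → ℝ) : Prop :=
  ∀ φ : E2 → ℝ, ContDiff ℝ (⊤ : ℕ∞) φ → HasCompactSupport φ → ∀ d : Fin 2,
    ∫ x in TT, (u x * Pd d φ x + Du d x * φ x) = 0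

lemma moll_ind (ψ u : E2 → ℝ) (z : E2) :
    ∫ y, TT.indicator u y * ψ (z - y) = ∫ y in TT, u y * ψ (z - y) := by
  rw [← integral_indicator measurableSet_TT]
  congr 1; funext y
  by_cases hy : y ∈ TT <;> simp [hy]

lemma moll_pd_weak {ψ u : E2 → ℝ} {Du : Fin 2 → E2 → ℝ} (hψ : ContDiff ℝ (⊤ : ℕ∞) ψ) (hc : HasCompactSupport ψ)
    (hu : Integrable u muT) (hDu : ∀ d, Integrable (Du d) muT) (h : W0 u Du) (d : Fin 2) :
    Pd d (moll ψ (TT.indicator u)) = moll ψ (TT.indicator (Du d)) := by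
  funext z
  have hi : Integrable (TT.indicator u) := (integrable_indicator_iff measurableSet_TT).2 hu
  rw [moll_pd hψ hc hi, moll, moll_ind, moll_ind]
  have hs : ContDiff ℝ (⊤ : ℕ∞) fun y => ψ (z - y) := hψ.comp (contDiff_const.sub contDiff_id)
  have hsc : HasCompactSupport fun y => ψ (z - y) := hc.comp_homeomorph (Homeomorph.subLeft z)
  have h1 := h _ hs hsc d
  have e : ∀ y, Pd d (fun y => ψ (z - y)) y = - Pd d ψ (z - y) := by
    intro y
    have h2 : HasFDerivAt ψ (fderiv ℝ ψ (z - y)) (z - y) := (hψ.differentiable (by simp) _).hasFDerivAt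
    have h3 := h2.comp y ((hasFDerivAt_const z y).sub (hasFDerivAt_id y))
    have h4 : HasFDerivAt (fun y => ψ (z - y)) ((fderiv ℝ ψ (z - y)).comp (0 - ContinuousLinearMap.id ℝ E2)) y := h3
    rw [Pd, h4.fderiv, Pd]
    simp
  have c1 : Continuous fun y => Pd d (fun y => ψ (z - y)) y := (Pd_contDiff hs d).continuous
  rw [integral_add (int_mul_test hu c1 (Pd_supp hsc d)) (int_mul_test (hDu d) hs.continuous hsc)] at h1
  simp only [e, mul_neg, integral_neg] at h1
  linarith

def cc : E2 := !₂[1/3, 1/3]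
def Ar (r : ℝ) (x : E2) : E2 := r • x + (cc - r • cc)

lemma Pd_dil {Φ : E2 → ℝ} (h : ContDiff ℝ (⊤ : ℕ∞) Φ) (r : ℝ) (d : Fin 2) :
    Pd d (fun x => Φ (Ar r x)) = fun x => r * Pd d Φ (Ar r x) := by
  funext x
  have h2 : HasFDerivAt Φ (fderiv ℝ Φ (Ar r x)) (Ar r x) := (h.differentiable (by simp) _).hasFDerivAt
  have h3 : HasFDerivAt (Ar r) (r • ContinuousLinearMap.id ℝ E2) x :=
    ((hasFDerivAt_id x).const_smul r).add_const _
  have h4 : HasFDerivAt (fun x => Φ (Ar r x)) _ x := h2.comp x h3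
  rw [Pd, h4.fderiv, Pd]
  simp

lemma dil_contDiff {Φ : E2 → ℝ} (h : ContDiff ℝ (⊤ : ℕ∞) Φ) (r : ℝ) :
    ContDiff ℝ (⊤ : ℕ∞) (fun x => Φ (Ar r x)) := by
  refine h.comp ?_
  unfold Ar; fun_prop

lemma lam_Ar (i : Fin 3) (r : ℝ) (x : E2) : lam i (Ar r x) = 1/3 + r * lam i x - r / 3 := by
  fin_cases i <;> simp [lam, Ar, cc] <;> ring

lemma abs_coord (x : E2) (i : Fin 2) : |x i| ≤ ‖x‖ := by
  have := PiLp.norm_apply_le x i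
  simpa using this

lemma lam_lip (i : Fin 3) (x y : E2) : lam i y - 2 * ‖x - y‖ ≤ lam i x := by
  have h0 := abs_le.1 (abs_coord (x - y) 0)
  have h1 := abs_le.1 (abs_coord (x - y) 1)
  simp at h0 h1
  have := norm_nonneg (x - y)
  fin_cases i <;> simp [lam] <;> linarith [h0.1, h0.2, h1.1, h1.2]

structure Mol (ε : ℝ) (ψ : E2 → ℝ) : Prop where
  sm : ContDiff ℝ (⊤ : ℕ∞) ψ
  cs : HasCompactSupport ψ
  nn : ∀ x, 0 ≤ ψ x
  i1 : ∫ x, ψ x = 1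
  sp : ∀ x, ε ≤ ‖x‖ → ψ x = 0

lemma mol_ex {ε : ℝ} (hε : 0 < ε) : ∃ ψ, Mol ε ψ := by
  let b : ContDiffBump (0 : E2) := ⟨ε / 2, ε, by linarith, by linarith⟩
  refine ⟨b.normed volume, b.contDiff_normed, b.hasCompactSupport_normed, b.nonneg_normed,
    b.integral_normed, fun x hx => ?_⟩
  by_contra hc
  have : x ∈ Function.support (b.normed volume) := hc
  rw [b.support_normed_eq] at this
  simp [b] at this
  linarith

lemma dil_supp {ε r : ℝ} {ψ u : E2 → ℝ} (hψ : Mol ε ψ) (hr : 0 < r) (h : 0 < (r - 1) / 3 - 2 * ε) :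
    HasCompactSupport (fun x => moll ψ (TT.indicator u) (Ar r x)) ∧
    tsupport (fun x => moll ψ (TT.indicator u) (Ar r x)) ⊆ TT := by
  let S : Set E2 := {x | ∀ i, (r - 1) / 3 - 2 * ε ≤ r * lam i x}
  have hS : IsClosed S := by
    have : S = ⋂ i, {x | (r - 1) / 3 - 2 * ε ≤ r * lam i x} := by ext x; simp [S]
    rw [this]
    exact isClosed_iInter fun i => isClosed_le continuous_const (continuous_const.mul (cont_lam i))
  have hST : S ⊆ TT := by
    intro x hx
    have hp : ∀ i, 0 < lam i x := fun i => pos_of_mul_pos_right (h.trans_le (hx i)) hr.le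
    have h0 := hp 0
    have h1 := hp 1
    have h2 := hp 2
    simp [lam] at h0 h1 h2
    exact ⟨h1, h2, by linarith⟩
  have hsup : Function.support (fun x => moll ψ (TT.indicator u) (Ar r x)) ⊆ S := by
    intro x hx
    by_contra hc
    apply hx
    simp only [S, mem_ofPred_eq, not_forall, not_le] at hc
    obtain ⟨i, hi⟩ := hc
    change moll ψ (TT.indicator u) (Ar r x) = 0
    rw [moll, moll_ind]
    refine (setIntegral_congr_fun measurableSet_TT fun y hy => ?_).trans (integral_zero _ _)
    have : ψ (Ar r x - y) = 0 := by
      apply hψ.sp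
      have h1 := lam_lip i (Ar r x) y
      rw [lam_Ar] at h1
      have h2 := lam_TT hy i
      linarith
    simp [this]
  have hts : tsupport (fun x => moll ψ (TT.indicator u) (Ar r x)) ⊆ S := closure_minimal hsup hS
  exact ⟨isCompact_TC.of_isClosed_subset (isClosed_tsupport _) ((hts.trans hST).trans TT_sub_TC),
    hts.trans hST⟩


/-! ### L² estimates for mollification -/

lemma sq_eLpNorm {μ : Measure E2} (f : E2 → ℝ) : eLpNorm f 2 μ ^ 2 = ∫⁻ x, ‖f x‖ₑ ^ 2 ∂μ := by
  have := eLpNorm_nnreal_pow_eq_lintegral (f := f) (μ := μ) (p := 2) (by norm_num)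
  simpa using this

lemma moll_swap (ψ u : E2 → ℝ) (z : E2) : moll ψ u z = ∫ y, u (z - y) * ψ y := by
  rw [moll, ← integral_sub_left_eq_self _ volume z]
  simp

lemma young {ε : ℝ} {ψ w : E2 → ℝ} (hψ : Mol ε ψ) (hw : StronglyMeasurable w) :
    eLpNorm (moll ψ w) 2 volume ≤ eLpNorm w 2 volume := by
  have hm : Measurable fun y => ENNReal.ofReal (ψ y) := hψ.sm.continuous.measurable.ennreal_ofReal
  let ν : Measure E2 := volume.withDensity fun y => ENNReal.ofReal (ψ y)
  have : IsProbabilityMeasure ν := ⟨by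
    rw [withDensity_apply _ MeasurableSet.univ, Measure.restrict_univ,
      ← ofReal_integral_eq_lintegral_ofReal (hψ.sm.continuous.integrable_of_hasCompactSupport hψ.cs)
        (Filter.Eventually.of_forall hψ.nn), hψ.i1, ENNReal.ofReal_one]⟩
  have hwm : ∀ z : E2, Measurable fun y => w (z - y) := fun z => hw.measurable.comp (measurable_const.sub measurable_id)
  have h1 : ∀ z, ‖moll ψ w z‖ₑ ^ 2 ≤ ∫⁻ y, ‖w (z - y)‖ₑ ^ 2 ∂ν := by
    intro z
    have a1 : ‖moll ψ w z‖ₑ ≤ eLpNorm (fun y => w (z - y)) 1 ν := by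
      rw [eLpNorm_one_eq_lintegral_enorm, moll_swap]
      refine (enorm_integral_le_lintegral_enorm _).trans (le_of_eq ?_)
      rw [lintegral_withDensity_eq_lintegral_mul _ hm (hwm z).enorm]
      congr 1; funext y
      rw [enorm_mul, Real.enorm_of_nonneg (hψ.nn y), Pi.mul_apply, mul_comm]
    have a2 := eLpNorm_le_eLpNorm_of_exponent_le (p := 1) (q := 2) (by norm_num) (μ := ν) (hwm z).aestronglyMeasurable
    rw [← sq_eLpNorm]
    gcongr
    exact a1.trans a2
  have h2 : eLpNorm (moll ψ w) 2 volume ^ 2 ≤ eLpNorm w 2 volume ^ 2 := by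
    rw [sq_eLpNorm, sq_eLpNorm]
    refine (lintegral_mono h1).trans (le_of_eq ?_)
    rw [lintegral_lintegral_swap]
    · have : ∀ y : E2, ∫⁻ z, ‖w (z - y)‖ₑ ^ 2 = ∫⁻ z, ‖w z‖ₑ ^ 2 := fun y =>
        lintegral_sub_right_eq_self (fun z => ‖w z‖ₑ ^ 2) y
      simp_rw [this]
      simp
    · refine Measurable.aemeasurable ?_
      have : Measurable fun q : E2 × E2 => w (q.1 - q.2) := hw.measurable.comp (measurable_fst.sub measurable_snd)
      exact this.enorm.pow_const 2
  by_contra hc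
  exact absurd h2 (not_le.2 (ENNReal.pow_lt_pow_left (by norm_num) (not_le.1 hc)))

lemma cont_Ar (r : ℝ) : Continuous (Ar r) := by unfold Ar; fun_prop

lemma dil_le {r : ℝ} (hr : 1 ≤ r) {q : E2 → ℝ} (hq : AEStronglyMeasurable q) :
    eLpNorm (fun x => q (Ar r x)) 2 muT ≤ eLpNorm q 2 volume := by
  have hr0 : r ≠ 0 := by linarith
  have hmap : Measure.map (Ar r) (volume : Measure E2) ≤ volume := by
    have e : Ar r = (fun x => x + (cc - r • cc)) ∘ (fun x => r • x) := rfl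
    rw [e, ← Measure.map_map (by fun_prop) (by fun_prop), Measure.map_addHaar_smul _ hr0, Measure.map_smul,
      (measurePreserving_add_right volume _).map_eq]
    have : ENNReal.ofReal |(r ^ Module.finrank ℝ E2)⁻¹| ≤ 1 := by
      rw [ENNReal.ofReal_le_one, abs_inv, abs_of_nonneg (by positivity)]
      exact inv_le_one_of_one_le₀ (one_le_pow₀ hr)
    intro s
    simp only [Measure.smul_apply, smul_eq_mul]
    exact mul_le_of_le_one_left' this
  have hac : AEStronglyMeasurable q (Measure.map (Ar r) (volume : Measure E2)) := hq.mono_measure hmap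
  calc eLpNorm (fun x => q (Ar r x)) 2 muT ≤ eLpNorm (q ∘ Ar r) 2 volume := eLpNorm_mono_measure _ Measure.restrict_le_self
    _ = eLpNorm q 2 (Measure.map (Ar r) volume) := (eLpNorm_map_measure hac (cont_Ar r).aemeasurable).symm
    _ ≤ _ := eLpNorm_mono_measure _ hmap

lemma TT_bdd {x : E2} (hx : x ∈ TT) : ‖x - cc‖ ≤ 2 := by
  obtain ⟨h1, h2, h3⟩ := hx
  rw [EuclideanSpace.norm_eq]
  apply Real.sqrt_le_iff.2
  constructor
  · norm_num
  · simp [cc]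
    nlinarith

lemma moll_exists {ε : ℝ} {ψ u : E2 → ℝ} (hψ : Mol ε ψ) (hu : MemLp u 2 volume) (z : E2) :
    Integrable fun y => u y * ψ (z - y) :=
  hψ.cs.convolutionExists_right (ContinuousLinearMap.mul ℝ ℝ) (hu.locallyIntegrable (by norm_num))
    hψ.sm.continuous z

lemma moll_cont {ε : ℝ} {ψ u : E2 → ℝ} (hψ : Mol ε ψ) (hu : MemLp u 2 volume) : Continuous (moll ψ u) := by
  rw [moll_eq]
  exact hψ.cs.continuous_convolution_right _ (hu.locallyIntegrable (by norm_num)) hψ.sm.continuous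

lemma conv_L2 {u : E2 → ℝ} (hu : MemLp u 2 volume) (hum : StronglyMeasurable u) {δ : ENNReal} (hδ : δ ≠ 0) :
    ∃ ε0 > 0, ∀ ε, 0 < ε → ε < ε0 → ∀ ψ, Mol ε ψ →
      eLpNorm (fun x => moll ψ u (Ar (1 + 9 * ε) x) - u x) 2 muT ≤ δ := by
  have hδ3 : δ / 3 ≠ 0 := by simp [hδ]
  obtain ⟨v, hvc, hv, hvcont, hvm⟩ := hu.exists_hasCompactSupport_eLpNorm_sub_le (by norm_num) hδ3
  obtain ⟨η, hη, hη2⟩ := ENNReal.exists_nnreal_pos_mul_lt (a := muT univ ^ (ENNReal.toReal 2)⁻¹) (b := δ / 3)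
    (by
      apply ENNReal.rpow_ne_top_of_nonneg (by simp)
      exact (measure_lt_top muT univ).ne) hδ3
  have huc := hvc.uniformContinuous_of_continuous hvcont
  rw [Metric.uniformContinuous_iff] at huc
  obtain ⟨κ, hκ, hvu⟩ := huc η (by exact_mod_cast hη)
  refine ⟨κ / 19, by positivity, fun ε h0 h1 ψ hψ => ?_⟩
  set r := 1 + 9 * ε with hr
  have e : (fun x => moll ψ u (Ar r x) - u x) =
      (fun x => moll ψ (u - v) (Ar r x)) + ((fun x => moll ψ v (Ar r x) - v x) + (v - u)) := by
    funext x
    have : moll ψ (u - v) (Ar r x) = moll ψ u (Ar r x) - moll ψ v (Ar r x) := by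
      rw [moll, moll, moll, ← integral_sub (moll_exists hψ hu _) (moll_exists hψ hvm _)]
      congr 1; funext y; simp; ring
    simp only [Pi.add_apply, Pi.sub_apply, this]; ring
  have b1 : eLpNorm (fun x => moll ψ (u - v) (Ar r x)) 2 muT ≤ δ / 3 :=
    (dil_le (by linarith) (moll_cont hψ (hu.sub hvm)).aestronglyMeasurable).trans
      ((young hψ (hum.sub hvcont.stronglyMeasurable)).trans hv)
  have b3 : eLpNorm (v - u) 2 muT ≤ δ / 3 := by
    rw [eLpNorm_sub_comm]
    exact (eLpNorm_mono_measure _ Measure.restrict_le_self).trans hv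
  have b2 : eLpNorm (fun x => moll ψ v (Ar r x) - v x) 2 muT ≤ δ / 3 := by
    have hb : ∀ᵐ x ∂muT, ‖moll ψ v (Ar r x) - v x‖ ≤ η := by
      filter_upwards [ae_restrict_mem measurableSet_TT] with x hx
      have hi := hψ.sm.continuous.integrable_of_hasCompactSupport hψ.cs (μ := volume)
      have hi2 : Integrable fun y => v (Ar r x - y) * ψ y :=
        (hψ.sm.continuous.integrable_of_hasCompactSupport hψ.cs (μ := volume)).bdd_mul
          (c := Classical.choose (hvc.exists_bound_of_continuous hvcont))
          (hvcont.comp (continuous_const.sub continuous_id)).aestronglyMeasurable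
          (Filter.Eventually.of_forall fun y => Classical.choose_spec (hvc.exists_bound_of_continuous hvcont) _)
      have e2 : moll ψ v (Ar r x) - v x = ∫ y, (v (Ar r x - y) - v x) * ψ y := by
        simp_rw [sub_mul]
        rw [integral_sub hi2 (hi.const_mul _), integral_const_mul, hψ.i1, mul_one, moll_swap]
      rw [e2]
      have := norm_integral_le_of_norm_le (f := fun y => (v (Ar r x - y) - v x) * ψ y) (hi.const_mul (η : ℝ))
        (Filter.Eventually.of_forall fun y => ?_)
      · rwa [integral_const_mul, hψ.i1, mul_one] at this
      · rw [norm_mul, Real.norm_of_nonneg (hψ.nn y)]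
        by_cases hy : ε ≤ ‖y‖
        · rw [hψ.sp y hy]; simp
        refine mul_le_mul_of_nonneg_right ?_ (hψ.nn y)
        rw [← dist_eq_norm]
        refine (hvu ?_).le
        have e3 : Ar r x - y - x = (9 * ε) • (x - cc) - y := by
          rw [Ar, hr]; module
        rw [dist_eq_norm, e3]
        have := TT_bdd hx
        calc ‖(9 * ε) • (x - cc) - y‖ ≤ ‖(9 * ε) • (x - cc)‖ + ‖y‖ := norm_sub_le _ _
          _ ≤ 9 * ε * 2 + ε := by
            rw [norm_smul, Real.norm_of_nonneg (by positivity)]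
            gcongr
            exact (not_le.1 hy).le
          _ < κ := by linarith
    refine (eLpNorm_le_of_ae_bound hb).trans ?_
    rw [ENNReal.ofReal_coe_nnreal, mul_comm]
    exact hη2.le
  rw [e]
  have hmv : AEStronglyMeasurable (fun x => moll ψ v (Ar r x) - v x) muT :=
    (((moll_cont hψ hvm).comp (cont_Ar r)).sub hvcont).aestronglyMeasurable
  have hmu : AEStronglyMeasurable (v - u) muT := (hvcont.stronglyMeasurable.sub hum).aestronglyMeasurable
  calc _ ≤ _ + _ := eLpNorm_add_le ((moll_cont hψ (hu.sub hvm)).comp (cont_Ar r)).aestronglyMeasurable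
          (hmv.add hmu) (by norm_num)
    _ ≤ δ / 3 + (δ / 3 + δ / 3) := by
      refine add_le_add b1 ?_
      exact (eLpNorm_add_le hmv hmu (by norm_num)).trans (add_le_add b2 b3)
    _ = δ := by rw [← add_assoc]; exact ENNReal.add_thirds δ


/-! ### The space of jets -/

abbrev JI := Unit ⊕ Fin 2 ⊕ (Fin 2 × Fin 2)
abbrev j0 : JI := Sum.inl ()
abbrev j1 (d : Fin 2) : JI := Sum.inr (Sum.inl d)
abbrev j2 (d d' : Fin 2) : JI := Sum.inr (Sum.inr (d, d'))

abbrev L2T := Lp ℝ 2 muT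
abbrev XX := PiLp 2 (fun _ : JI => L2T)

def DD : JI → (E2 → ℝ) → E2 → ℝ
  | Sum.inl _, φ => φ
  | Sum.inr (Sum.inl d), φ => Pd d φ
  | Sum.inr (Sum.inr (d, d')), φ => Pd d' (Pd d φ)

def ordJ : JI → ℕ
  | Sum.inl _ => 0
  | Sum.inr (Sum.inl _) => 1
  | Sum.inr (Sum.inr _) => 2

structure Tst (φ : E2 → ℝ) : Prop where
  sm : ContDiff ℝ (⊤ : ℕ∞) φ
  cs : HasCompactSupport φ
  ts : tsupport φ ⊆ TT

lemma Tst.pd {φ : E2 → ℝ} (h : Tst φ) (d : Fin 2) : Tst (Pd d φ) :=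
  ⟨Pd_contDiff h.sm d, Pd_supp h.cs d, (Pd_tsupp d).trans h.ts⟩

lemma Tst.dd {φ : E2 → ℝ} (h : Tst φ) (i : JI) : Tst (DD i φ) := by
  rcases i with _ | d | ⟨d, d'⟩
  · exact h
  · exact h.pd d
  · exact (h.pd d).pd d'

lemma Tst.memLp {φ : E2 → ℝ} (h : Tst φ) : MemLp φ 2 muT := memLp_TC h.sm.continuous.continuousOn

lemma Pd_add {φ φ' : E2 → ℝ} (h : ContDiff ℝ (⊤ : ℕ∞) φ) (h' : ContDiff ℝ (⊤ : ℕ∞) φ') (d : Fin 2) :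
    Pd d (φ + φ') = Pd d φ + Pd d φ' := by
  funext x
  simp only [Pd, Pi.add_apply]
  rw [fderiv_add (h.differentiable (by simp) x) (h'.differentiable (by simp) x)]; rfl

lemma Pd_smul {φ : E2 → ℝ} (h : ContDiff ℝ (⊤ : ℕ∞) φ) (c : ℝ) (d : Fin 2) :
    Pd d (c • φ) = c • Pd d φ := by
  funext x
  simp only [Pd, Pi.smul_apply]
  rw [fderiv_const_smul (h.differentiable (by simp) x)]; rfl

lemma DD_add {φ φ' : E2 → ℝ} (h : ContDiff ℝ (⊤ : ℕ∞) φ) (h' : ContDiff ℝ (⊤ : ℕ∞) φ') (i : JI) :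
    DD i (φ + φ') = DD i φ + DD i φ' := by
  rcases i with _ | d | ⟨d, d'⟩
  · rfl
  · exact Pd_add h h' d
  · simp only [DD]; rw [Pd_add h h' d, Pd_add (Pd_contDiff h d) (Pd_contDiff h' d)]

lemma DD_smul {φ : E2 → ℝ} (h : ContDiff ℝ (⊤ : ℕ∞) φ) (c : ℝ) (i : JI) :
    DD i (c • φ) = c • DD i φ := by
  rcases i with _ | d | ⟨d, d'⟩
  · rfl
  · exact Pd_smul h c d
  · simp only [DD]; rw [Pd_smul h c d, Pd_smul (Pd_contDiff h d)]

def testSub : Submodule ℝ XX where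
  carrier := {J | ∃ φ, Tst φ ∧ ∀ i, J i =ᵐ[muT] DD i φ}
  add_mem' := by
    rintro J J' ⟨φ, h, e⟩ ⟨φ', h', e'⟩
    refine ⟨φ + φ', ⟨h.sm.add h'.sm, h.cs.add h'.cs, (tsupport_add φ φ').trans (union_subset h.ts h'.ts)⟩, fun i => ?_⟩
    rw [DD_add h.sm h'.sm]
    exact (Lp.coeFn_add (J i) (J' i)).trans ((e i).add (e' i))
  zero_mem' := by
    refine ⟨0, ⟨contDiff_const, HasCompactSupport.zero, by simp [tsupport]⟩, fun i => ?_⟩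
    have : DD i 0 = 0 := by
      have := DD_smul (φ := 0) contDiff_const 0 i
      simpa using this
    rw [this]
    exact Lp.coeFn_zero ℝ 2 muT
  smul_mem' := by
    rintro c J ⟨φ, h, e⟩
    refine ⟨c • φ, ⟨h.sm.const_smul c, h.cs.smul_left (f := fun _ => c), (tsupport_smul_subset_right (fun _ => c) φ).trans h.ts⟩, fun i => ?_⟩
    rw [DD_smul h.sm]
    exact (Lp.coeFn_smul c (J i)).trans ((e i).const_smul c)

def HH : Submodule ℝ XX := testSub.topologicalClosure

def jet {φ : E2 → ℝ} (h : Tst φ) : XX := WithLp.toLp 2 fun i => (h.dd i).memLp.toLp (DD i φ)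

lemma jet_ae {φ : E2 → ℝ} (h : Tst φ) (i : JI) : jet h i =ᵐ[muT] DD i φ := MemLp.coeFn_toLp (h.dd i).memLp

lemma jet_mem {φ : E2 → ℝ} (h : Tst φ) : jet h ∈ HH :=
  Submodule.le_topologicalClosure _ ⟨φ, h, jet_ae h⟩

lemma HH_induct {p : XX → Prop} (hc : IsClosed {J | p J}) (h : ∀ φ (h : Tst φ), p (jet h)) :
    ∀ J ∈ HH, p J := by
  intro J hJ
  have : (HH : Set XX) ⊆ {J | p J} := by
    rw [HH, Submodule.topologicalClosure_coe]
    refine closure_minimal ?_ hc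
    rintro J ⟨φ, h1, h2⟩
    have : J = jet h1 := by
      ext i : 1
      exact Lp.ext ((h2 i).trans (jet_ae h1 i).symm)
    rw [this]
    exact h φ h1
  exact this hJ

/-- zero traces -/
def ZT (J : XX) : Prop := W0 (J j0) (fun d => J (j1 d)) ∧ ∀ d, W0 (J (j1 d)) (fun d' => J (j2 d d'))

lemma L2T_int (u : L2T) : Integrable u muT := int_of_L2 (Lp.memLp u)

lemma dil_jet {ε r : ℝ} {ψ : E2 → ℝ} (hψ : Mol ε ψ) {J : XX} (h : ZT J) (i : JI) :
    DD i (fun x => moll ψ (TT.indicator (J j0)) (Ar r x)) =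
      fun x => r ^ ordJ i * moll ψ (TT.indicator (J i)) (Ar r x) := by
  have hI : ∀ i, Integrable (TT.indicator (J i)) := fun i => (integrable_indicator_iff measurableSet_TT).2 (L2T_int _)
  have hC : ∀ i, ContDiff ℝ (⊤ : ℕ∞) (moll ψ (TT.indicator (J i))) := fun i => moll_contDiff hψ.sm hψ.cs (hI i)
  have e1 : ∀ d, Pd d (fun x => moll ψ (TT.indicator (J j0)) (Ar r x)) =
      fun x => r * moll ψ (TT.indicator (J (j1 d))) (Ar r x) := by
    intro d
    rw [Pd_dil (hC _), moll_pd_weak hψ.sm hψ.cs (L2T_int _) (fun d => L2T_int _) h.1]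
  rcases i with _ | d | ⟨d, d'⟩
  · simp [DD, ordJ]
  · simp only [DD, ordJ, pow_one]; exact e1 d
  · simp only [DD, ordJ]
    rw [e1]
    have : (fun x => r * moll ψ (TT.indicator (J (j1 d))) (Ar r x)) = r • fun x => moll ψ (TT.indicator (J (j1 d))) (Ar r x) := rfl
    rw [this, Pd_smul (dil_contDiff (hC _) r), Pd_dil (hC _),
      moll_pd_weak hψ.sm hψ.cs (L2T_int _) (fun d => L2T_int _) (h.2 d)]
    funext x
    simp; ring

lemma mem_HH_of_ZT {J : XX} (h : ZT J) : J ∈ HH := by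
  let ε : ℕ → ℝ := fun n => 1 / ((n : ℝ) + 1)
  have hε : ∀ n, 0 < ε n := fun n => by positivity
  have hε0 : Filter.Tendsto ε Filter.atTop (nhds 0) := tendsto_one_div_add_atTop_nhds_zero_nat
  choose ψ hψ using fun n => mol_ex (hε n)
  let u : JI → E2 → ℝ := fun i => TT.indicator (J i)
  have hum : ∀ i, StronglyMeasurable (u i) := fun i => (Lp.stronglyMeasurable (J i)).indicator measurableSet_TT
  have hu : ∀ i, MemLp (u i) 2 volume := fun i => (memLp_indicator_iff_restrict measurableSet_TT).2 (Lp.memLp _)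
  let q : JI → ℕ → E2 → ℝ := fun i n x => moll (ψ n) (u i) (Ar (1 + 9 * ε n) x)
  have hq : ∀ i n, MemLp (q i n) 2 muT := fun i n =>
    memLp_TC ((moll_cont (hψ n) (hu i)).comp (cont_Ar _)).continuousOn
  have hlim : ∀ i, Filter.Tendsto (fun n => (hq i n).toLp (q i n)) Filter.atTop (nhds (J i)) := by
    intro i
    have e : J i = (Lp.memLp (J i)).toLp (J i) := (Lp.toLp_coeFn _ _).symm
    rw [e, Lp.tendsto_Lp_iff_tendsto_eLpNorm'', ENNReal.tendsto_nhds_zero]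
    intro δ hδ
    obtain ⟨ε0, h0, h1⟩ := conv_L2 (hu i) (hum i) hδ.ne'
    filter_upwards [hε0.eventually (gt_mem_nhds h0)] with n hn
    refine le_trans (le_of_eq (eLpNorm_congr_ae ?_)) (h1 (ε n) (hε n) hn (ψ n) (hψ n))
    filter_upwards [ae_restrict_mem measurableSet_TT] with x hx
    simp [q, u, hx]
  have hr : Filter.Tendsto (fun n => 1 + 9 * ε n) Filter.atTop (nhds 1) := by
    have := (hε0.const_mul 9).const_add 1
    simpa using this
  have hlim2 : Filter.Tendsto (fun n => (WithLp.toLp 2 fun i => (1 + 9 * ε n) ^ ordJ i • (hq i n).toLp (q i n) : XX))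
      Filter.atTop (nhds J) := by
    have : J = WithLp.toLp 2 fun i => J i := rfl
    rw [this]
    refine ((PiLp.continuous_toLp 2 _).tendsto _).comp (tendsto_pi_nhds.2 fun i => ?_)
    have := (hr.pow (ordJ i)).smul (hlim i)
    simpa using this
  refine mem_closure_of_tendsto (s := (testSub : Set XX)) hlim2 (Filter.Eventually.of_forall fun n => ?_)
  have hpos : 0 < (1 + 9 * ε n - 1) / 3 - 2 * ε n := by linarith [hε n]
  obtain ⟨s1, s2⟩ := dil_supp (u := J j0) (hψ n) (by linarith [hε n]) hpos
  have hI : Integrable (TT.indicator (J j0)) := (integrable_indicator_iff measurableSet_TT).2 (L2T_int _)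
  refine ⟨fun x => moll (ψ n) (TT.indicator (J j0)) (Ar (1 + 9 * ε n) x),
    ⟨dil_contDiff (moll_contDiff (hψ n).sm (hψ n).cs hI) _, s1, s2⟩, fun i => ?_⟩
  rw [dil_jet (hψ n) h]
  exact (Lp.coeFn_smul _ _).trans ((MemLp.coeFn_toLp (hq i n)).const_smul _)


/-! ### The Hilbert space problem -/

lemma inner_L2 (u : L2T) {v : E2 → ℝ} (h : MemLp v 2 muT) :
    ⟪u, h.toLp v⟫ = ∫ x in TT, u x * v x := by
  rw [L2.inner_def]
  refine integral_congr_ae ?_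
  filter_upwards [h.coeFn_toLp] with x hx
  rw [hx]
  simp [mul_comm]

lemma int_mul_L2 {u v : E2 → ℝ} (hu : MemLp u 2 muT) (hv : MemLp v 2 muT) :
    Integrable (fun x => u x * v x) muT := hu.integrable_mul hv

lemma W0_iff (u : L2T) (Du : Fin 2 → L2T) : W0 u (fun d => Du d) ↔
    ∀ φ : E2 → ℝ, ∀ h : ContDiff ℝ (⊤ : ℕ∞) φ, ∀ _ : HasCompactSupport φ, ∀ d : Fin 2,
      ⟪u, (memLp_TC (Pd_contDiff h d).continuous.continuousOn).toLp (Pd d φ)⟫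
        + ⟪Du d, (memLp_TC h.continuous.continuousOn).toLp φ⟫ = 0 := by
  unfold W0
  refine forall_congr' fun φ => forall_congr' fun h => forall_congr' fun h' => forall_congr' fun d => ?_
  rw [inner_L2, inner_L2, integral_add]
  · exact int_mul_L2 (Lp.memLp _) (memLp_TC (Pd_contDiff h d).continuous.continuousOn)
  · exact int_mul_L2 (Lp.memLp _) (memLp_TC h.continuous.continuousOn)

lemma W0_closed (i : JI) (k : Fin 2 → JI) : IsClosed {J : XX | W0 (J i) (fun d => J (k d))} := by
  have : {J : XX | W0 (J i) (fun d => J (k d))} = {J : XX | ∀ φ : E2 → ℝ, ∀ h : ContDiff ℝ (⊤ : ℕ∞) φ,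
      ∀ _ : HasCompactSupport φ, ∀ d : Fin 2,
      ⟪J i, (memLp_TC (Pd_contDiff h d).continuous.continuousOn).toLp (Pd d φ)⟫
        + ⟪J (k d), (memLp_TC h.continuous.continuousOn).toLp φ⟫ = 0} := by
    ext J
    exact W0_iff (J i) fun d => J (k d)
  rw [this]
  simp only [Set.setOf_forall]
  refine isClosed_iInter fun φ => isClosed_iInter fun h => isClosed_iInter fun h' => isClosed_iInter fun d => ?_
  refine isClosed_eq ?_ continuous_const
  have c1 : ∀ i, Continuous fun J : XX => J i := fun i => (PiLp.continuous_apply 2 _ i)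
  exact ((c1 i).inner continuous_const).add ((c1 (k d)).inner continuous_const)

lemma Tst.bd {φ : E2 → ℝ} (h : Tst φ) (j : Fin 3) (t : ℝ) : φ (epar refTri j t) = 0 := by
  by_contra hne
  exact epar_not_mem_TT j t (h.ts (subset_tsupport _ hne))

lemma Tst.hasFD {φ : E2 → ℝ} (h : Tst φ) (x : E2) : HasFDerivAt φ (dl fun d => Pd d φ x) x := by
  refine (h.sm.differentiable (by simp) x).hasFDerivAt.congr_fderiv ?_
  ext v
  rw [dl_apply]
  have : v = v 0 • stdb2 0 + v 1 • stdb2 1 := by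
    ext i; fin_cases i <;> simp [stdb2]
  conv_lhs => rw [this]
  simp only [map_add, map_smul, Pd, smul_eq_mul]
  ring

lemma W0_tst {φ : E2 → ℝ} (h : Tst φ) : W0 φ (fun d => Pd d φ) := by
  intro ψ hψ hc d
  have := faceTrace_of φ (fun d => Pd d φ) h.sm.continuous.continuousOn
    (fun d => integrableOn_TT _ (h.pd d).sm.continuous.continuousOn) (fun x _ => h.hasFD x) ψ hψ hc d
  rw [tri_eq] at this
  refine this.trans ?_
  simp [h.bd]

lemma W0.congr {u u' : E2 → ℝ} {D D' : Fin 2 → E2 → ℝ} (h : W0 u D) (e : u' =ᵐ[muT] u)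
    (e' : ∀ d, D' d =ᵐ[muT] D d) : W0 u' D' := by
  intro φ hφ hc d
  rw [← h φ hφ hc d]
  refine integral_congr_ae ?_
  filter_upwards [e, e' d] with x h1 h2
  rw [h1, h2]

lemma ZT_of_mem_HH {J : XX} (h : J ∈ HH) : ZT J := by
  refine HH_induct (p := ZT) ?_ ?_ J h
  · have : {J | ZT J} = {J : XX | W0 (J j0) (fun d => J (j1 d))} ∩ ⋂ d, {J : XX | W0 (J (j1 d)) (fun d' => J (j2 d d'))} := by
      ext J; simp [ZT]
    rw [this]
    exact (W0_closed _ _).inter (isClosed_iInter fun d => W0_closed _ _)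
  · intro φ h
    exact ⟨(W0_tst h).congr (jet_ae h j0) fun d => jet_ae h (j1 d),
      fun d => (W0_tst (h.pd d)).congr (jet_ae h (j1 d)) fun d' => jet_ae h (j2 d d')⟩

lemma poincare {φ : E2 → ℝ} (h : Tst φ) : ∫ x in TT, φ x ^ 2 ≤ 4 * ∫ x in TT, Pd 0 φ x ^ 2 := by
  have c0 := h.sm.continuous
  have c1 := (h.pd 0).sm.continuous
  have cx : Continuous fun x : E2 => x 0 := by fun_prop
  have i1 : IntegrableOn (fun x : E2 => φ x ^ 2 + x 0 * (2 * φ x * Pd 0 φ x)) TT :=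
    integrableOn_TT _ (by fun_prop)
  have key := div_thm (fun x => x 0 * φ x ^ 2) (fun x => φ x ^ 2 + x 0 * (2 * φ x * Pd 0 φ x))
    (by fun_prop) i1 0 (by
      intro x _
      have hl : HasDerivAt (fun s : ℝ => x + s • stdb2 0) (stdb2 0) 0 := by
        have := ((hasDerivAt_id (0:ℝ)).smul_const (stdb2 0)).const_add x
        simpa using this
      have h1 : HasDerivAt (fun s : ℝ => φ (x + s • stdb2 0)) (Pd 0 φ x) 0 := by
        have hf : HasFDerivAt φ (fderiv ℝ φ x) (x + (0:ℝ) • stdb2 0) := by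
          simpa using (h.sm.differentiable (by simp) x).hasFDerivAt
        exact hf.comp_hasDerivAt 0 hl
      have h2 : HasDerivAt (fun s : ℝ => (x + s • stdb2 0) 0) 1 0 := by
        have : (fun s : ℝ => (x + s • stdb2 0) 0) = fun s => x 0 + s := by
          funext s; simp [stdb2]
        rw [this]
        exact (hasDerivAt_id (0:ℝ)).const_add _
      refine (h2.mul (h1.pow 2)).congr_deriv ?_
      simp)
  have z : ∑ j : Fin 3, nn j 0 * ∫ t in Ioo (0:ℝ) 1, (epar refTri j t) 0 * φ (epar refTri j t) ^ 2 = 0 := by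
    simp [h.bd]
  rw [z] at key
  have i2 : IntegrableOn (fun x : E2 => Pd 0 φ x ^ 2) TT := integrableOn_TT _ (by fun_prop)
  calc ∫ x in TT, φ x ^ 2 ≤ ∫ x in TT, (2 * (φ x ^ 2 + x 0 * (2 * φ x * Pd 0 φ x)) + 4 * Pd 0 φ x ^ 2) := by
        refine setIntegral_mono_on (integrableOn_TT _ (by fun_prop)) ((i1.const_mul 2).add (i2.const_mul 4)) measurableSet_TT ?_
        intro x hx
        have hx0 : 0 < x 0 := hx.1
        have hx1 : x 0 < 1 := by have := hx.2.1; have := hx.2.2; linarith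
        nlinarith [sq_nonneg (φ x + 2 * x 0 * Pd 0 φ x), mul_nonneg (sq_nonneg (Pd 0 φ x)) (by nlinarith : 0 ≤ 1 - x 0 ^ 2)]
    _ = 4 * ∫ x in TT, Pd 0 φ x ^ 2 := by
        rw [integral_add (i1.const_mul 2) (i2.const_mul 4), integral_const_mul, key, integral_const_mul]
        simp

lemma normsq_L2 {v : E2 → ℝ} (u : L2T) (h : u =ᵐ[muT] v) : ‖u‖ ^ 2 = ∫ x in TT, v x ^ 2 := by
  rw [← real_inner_self_eq_norm_sq, L2.inner_def]
  refine integral_congr_ae ?_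
  filter_upwards [h] with x hx
  rw [hx]
  simp [sq]

lemma poincare_HH {J : XX} (h : J ∈ HH) :
    ‖J j0‖ ^ 2 ≤ 4 * ‖J (j1 0)‖ ^ 2 ∧ ∀ d, ‖J (j1 d)‖ ^ 2 ≤ 4 * ‖J (j2 d 0)‖ ^ 2 := by
  refine HH_induct (p := fun J : XX => ‖J j0‖ ^ 2 ≤ 4 * ‖J (j1 0)‖ ^ 2 ∧ ∀ d, ‖J (j1 d)‖ ^ 2 ≤ 4 * ‖J (j2 d 0)‖ ^ 2) ?_ ?_ J h
  · have c1 : ∀ i, Continuous fun J : XX => ‖J i‖ ^ 2 := fun i => ((PiLp.continuous_apply 2 _ i).norm).pow 2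
    simp only [Set.setOf_and, Set.setOf_forall]
    exact (isClosed_le (c1 _) ((c1 _).const_mul 4)).inter
      (isClosed_iInter fun d => isClosed_le (c1 _) ((c1 _).const_mul 4))
  · intro φ h
    refine ⟨?_, fun d => ?_⟩
    · rw [normsq_L2 _ (jet_ae h j0), normsq_L2 _ (jet_ae h (j1 0))]
      exact poincare h
    · rw [normsq_L2 _ (jet_ae h (j1 d)), normsq_L2 _ (jet_ae h (j2 d 0))]
      exact poincare (h.pd d)

def pr (i : JI) : XX →L[ℝ] L2T := PiLp.proj 2 (fun _ : JI => L2T) i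

lemma pr_apply (i : JI) (J : XX) : pr i J = J i := rfl

/-- the energy form -/
def aa (u v : XX) : ℝ := ∑ d, ∑ d', ⟪u (j2 d d'), v (j2 d d')⟫

lemma aa_coer {J : XX} (h : J ∈ HH) : ‖J‖ ^ 2 ≤ 21 * aa J J := by
  obtain ⟨h0, h1⟩ := poincare_HH h
  rw [PiLp.norm_sq_eq_of_L2, Fintype.sum_sum_type, Fintype.sum_sum_type, Fintype.sum_prod_type]
  simp only [aa, Fin.sum_univ_two, real_inner_self_eq_norm_sq, Finset.univ_unique, Finset.sum_singleton]
  have a0 := h1 0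
  have a1 := h1 1
  have := sq_nonneg ‖J (j2 0 1)‖
  have := sq_nonneg ‖J (j2 1 1)‖
  have := sq_nonneg ‖J (j2 1 0)‖
  have := sq_nonneg ‖J (j2 0 0)‖
  simp only [j0, j1, j2] at *
  change ‖J (Sum.inl ())‖ ^ 2 + _ ≤ _
  linarith

def aaB : HH →L[ℝ] HH →L[ℝ] ℝ :=
  ∑ d, ∑ d', (innerSL ℝ : L2T →L[ℝ] L2T →L[ℝ] ℝ).bilinearComp
    ((pr (j2 d d')).comp HH.subtypeL) ((pr (j2 d d')).comp HH.subtypeL)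

lemma aaB_apply (u v : HH) : aaB u v = aa u v := by
  simp [aaB, aa, pr_apply]

instance : CompleteSpace HH := (Submodule.isClosed_topologicalClosure _).completeSpace_coe

lemma aaB_coer : IsCoercive aaB := by
  refine ⟨1 / 21, by norm_num, fun u => ?_⟩
  rw [aaB_apply]
  have := aa_coer u.2
  have e : ‖(u : XX)‖ = ‖u‖ := rfl
  rw [e] at this
  nlinarith

lemma solve (l : XX →L[ℝ] ℝ) : ∃ u ∈ HH, ∀ v ∈ HH, aa u v = l v := by
  let c := (InnerProductSpace.toDual ℝ HH).symm (l.comp HH.subtypeL)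
  obtain ⟨u, hu⟩ := aaB_coer.continuousLinearEquivOfBilin.surjective c
  refine ⟨u, u.2, fun v hv => ?_⟩
  have := aaB_coer.continuousLinearEquivOfBilin_apply u ⟨v, hv⟩
  rw [aaB_apply, hu] at this
  rw [← this]
  simp [c]

lemma aa_zero {J : XX} (h : J ∈ HH) (h0 : aa J J = 0) : J = 0 := by
  have := aa_coer h
  rw [h0] at this
  have : ‖J‖ = 0 := by nlinarith [norm_nonneg J]
  exact norm_eq_zero.1 this


/-! ### The weak bilaplacian -/

lemma Pd_comm {φ : E2 → ℝ} (h : ContDiff ℝ (⊤ : ℕ∞) φ) (d d' : Fin 2) :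
    Pd d (Pd d' φ) = Pd d' (Pd d φ) := by
  funext x
  have hd : DifferentiableAt ℝ (fderiv ℝ φ) x :=
    ((h.fderiv_right (m := (⊤ : ℕ∞)) (by norm_cast)).differentiable (by simp)) x
  have hs : IsSymmSndFDerivAt ℝ φ x := (contDiff_infty.1 h 2).contDiffAt.isSymmSndFDerivAt (by simp)
  have e : ∀ v w : E2, fderiv ℝ (fun y => fderiv ℝ φ y v) x w = fderiv ℝ (fderiv ℝ φ) x w v := by
    intro v w
    rw [fderiv_clm_apply hd (differentiableAt_const v)]
    simp
  unfold Pd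
  rw [e, e, hs.eq]

lemma lap_eq (φ : E2 → ℝ) : lap φ = Pd 0 (Pd 0 φ) + Pd 1 (Pd 1 φ) := by
  funext x
  simp only [lap, Fin.sum_univ_two]; rfl

lemma laplap_eq {φ : E2 → ℝ} (h : ContDiff ℝ (⊤ : ℕ∞) φ) (x : E2) :
    lap (lap φ) x = ∑ d, ∑ d', Pd d (Pd d' (DD (j2 d d') φ)) x := by
  have s : ∀ d {ψ : E2 → ℝ}, ContDiff ℝ (⊤ : ℕ∞) ψ → ContDiff ℝ (⊤ : ℕ∞) (Pd d ψ) := fun d ψ h => Pd_contDiff h d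
  have a0 := s 0 (s 0 h)
  have a1 := s 1 (s 1 h)
  have e01 : Pd 0 (Pd 0 (Pd 1 (Pd 1 φ))) = Pd 0 (Pd 1 (Pd 1 (Pd 0 φ))) := by
    rw [Pd_comm (s 1 h) 0 1, Pd_comm h 0 1]
  have e10 : Pd 1 (Pd 1 (Pd 0 (Pd 0 φ))) = Pd 1 (Pd 0 (Pd 0 (Pd 1 φ))) := by
    rw [Pd_comm (s 0 h) 1 0, Pd_comm h 1 0]
  rw [lap_eq, lap_eq, Pd_add a0 a1, Pd_add a0 a1, Pd_add (s 0 a0) (s 0 a1), Pd_add (s 1 a0) (s 1 a1), e01, e10]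
  simp only [DD, Fin.sum_univ_two, Pi.add_apply]

lemma bilap {ξ : E2 → ℝ} {G : Fin 2 → E2 → ℝ} {Hs : Fin 2 → Fin 2 → E2 → ℝ}
    (h : MemH2W (tri refTri) ξ G Hs) {φ : E2 → ℝ} (hφ : Tst φ) :
    ∫ x in TT, ξ x * lap (lap φ) x = ∑ d, ∑ d', ∫ x in TT, Hs d d' x * DD (j2 d d') φ x := by
  rw [tri_eq] at h
  obtain ⟨h0, h1, h2⟩ := h
  have hT : ∀ d d', Tst (DD (j2 d d') φ) := fun d d' => hφ.dd _
  have int : ∀ d d', Integrable (fun x => ξ x * Pd d (Pd d' (DD (j2 d d') φ)) x) muT := fun d d' =>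
    int_mul_L2 h0 (((hT d d').pd d').pd d).memLp
  simp_rw [laplap_eq hφ.sm, Finset.mul_sum]
  rw [integral_finsetSum _ (fun d _ => integrable_finsetSum _ fun d' _ => int d d')]
  refine Finset.sum_congr rfl fun d _ => ?_
  rw [integral_finsetSum _ (fun d' _ => int d d')]
  refine Finset.sum_congr rfl fun d' _ => ?_
  have t1 := (hT d d').pd d'
  have e1 := (h1 d).2 _ t1.sm t1.cs t1.ts
  have e2 := (h2 d d').2 _ (hT d d').sm (hT d d').cs (hT d d').ts
  have e3 : ∫ x in TT, ξ x * Pd d (Pd d' (DD (j2 d d') φ)) x = - ∫ x in TT, G d x * Pd d' (DD (j2 d d') φ) x := e1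
  have e4 : ∫ x in TT, G d x * Pd d' (DD (j2 d d') φ) x = - ∫ x in TT, Hs d d' x * DD (j2 d d') φ x := e2
  rw [e3, e4, neg_neg]

def dat (ξ : E2 → ℝ) (G : Fin 2 → E2 → ℝ) (Hs : Fin 2 → Fin 2 → E2 → ℝ) : JI → E2 → ℝ
  | Sum.inl _ => ξ
  | Sum.inr (Sum.inl d) => G d
  | Sum.inr (Sum.inr (d, d')) => Hs d d'

lemma dat_memLp {ξ : E2 → ℝ} {G : Fin 2 → E2 → ℝ} {Hs : Fin 2 → Fin 2 → E2 → ℝ}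
    (h : MemH2W (tri refTri) ξ G Hs) (i : JI) : MemLp (dat ξ G Hs i) 2 muT := by
  rw [tri_eq] at h
  rcases i with _ | d | ⟨d, d'⟩
  · exact h.1
  · exact (h.2.1 d).1
  · exact (h.2.2 d d').1

def toX {ξ : E2 → ℝ} {G : Fin 2 → E2 → ℝ} {Hs : Fin 2 → Fin 2 → E2 → ℝ}
    (h : MemH2W (tri refTri) ξ G Hs) : XX := WithLp.toLp 2 fun i => (dat_memLp h i).toLp (dat ξ G Hs i)

lemma toX_ae {ξ : E2 → ℝ} {G : Fin 2 → E2 → ℝ} {Hs : Fin 2 → Fin 2 → E2 → ℝ}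
    (h : MemH2W (tri refTri) ξ G Hs) (i : JI) : toX h i =ᵐ[muT] dat ξ G Hs i :=
  MemLp.coeFn_toLp (dat_memLp h i)

lemma bilap_aa {ξ : E2 → ℝ} {G : Fin 2 → E2 → ℝ} {Hs : Fin 2 → Fin 2 → E2 → ℝ}
    (h : MemH2W (tri refTri) ξ G Hs) {φ : E2 → ℝ} (hφ : Tst φ) :
    ∫ x in TT, ξ x * lap (lap φ) x = aa (toX h) (jet hφ) := by
  rw [bilap h hφ, aa]
  refine Finset.sum_congr rfl fun d _ => Finset.sum_congr rfl fun d' _ => ?_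
  have : jet hφ (j2 d d') = (hφ.dd (j2 d d')).memLp.toLp (DD (j2 d d') φ) := rfl
  rw [this, inner_L2]
  refine integral_congr_ae ?_
  filter_upwards [toX_ae h (j2 d d')] with x hx
  rw [hx]; rfl

/-! ### Interior moments -/

/-- pairing of the zeroth component with a continuous function -/
def mo {m : E2 → ℝ} (hm : Continuous m) : XX →L[ℝ] ℝ :=
  (innerSL ℝ ((memLp_TC hm.continuousOn).toLp m)).comp (pr j0)

lemma mo_apply {m : E2 → ℝ} (hm : Continuous m) (J : XX) : mo hm J = ∫ x in TT, J j0 x * m x := by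
  simp only [mo, ContinuousLinearMap.comp_apply, pr_apply, innerSL_apply_apply]
  rw [real_inner_comm, inner_L2]

lemma mo_jet {m : E2 → ℝ} (hm : Continuous m) {φ : E2 → ℝ} (h : Tst φ) :
    mo hm (jet h) = ∫ x in TT, m x * φ x := by
  rw [mo_apply]
  refine integral_congr_ae ?_
  filter_upwards [jet_ae h j0] with x hx
  rw [hx, mul_comm]; rfl

lemma aa_add_left (u u' v : XX) : aa (u + u') v = aa u v + aa u' v := by
  simp only [aa, PiLp.add_apply, inner_add_left, Finset.sum_add_distrib]

lemma aa_smul_left (c : ℝ) (u v : XX) : aa (c • u) v = c * aa u v := by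
  simp only [aa, PiLp.smul_apply, real_inner_smul_left, Finset.mul_sum]

lemma aa_sum_left {ι : Type} (s : Finset ι) (u : ι → XX) (v : XX) : aa (∑ i ∈ s, u i) v = ∑ i ∈ s, aa (u i) v := by
  classical
  induction s using Finset.induction_on with
  | empty => simp [aa]
  | insert a s ha ih => rw [Finset.sum_insert ha, Finset.sum_insert ha, aa_add_left, ih]

lemma zero_of_test {m : E2 → ℝ} (hm : Continuous m) (h : ∀ φ, Tst φ → ∫ x in TT, m x * φ x = 0) :
    ∀ x ∈ TT, m x = 0 := by
  have h1 := isOpen_TT.ae_eq_zero_of_integral_contDiff_smul_eq_zero (μ := (volume : Measure E2)) (f := m)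
    (hm.locallyIntegrable.locallyIntegrableOn TT) (by
      intro g g1 g2 g3
      rw [← h g ⟨g1, g2, g3⟩, ← setIntegral_eq_integral_of_forall_compl_eq_zero (s := TT)]
      · exact integral_congr_ae (Filter.Eventually.of_forall fun x => by simp [mul_comm])
      · intro x hx
        have : g x = 0 := by
          by_contra hne
          exact hx (g3 (subset_tsupport _ hne))
        simp [this])
  have h2 : m =ᵐ[volume.restrict TT] fun _ => 0 := (ae_restrict_iff' measurableSet_TT).2 h1
  exact Measure.eqOn_open_of_ae_eq h2 isOpen_TT hm.continuousOn continuousOn_const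

lemma moments {ι : Type} [Fintype ι] {m : ι → E2 → ℝ} (hm : ∀ i, Continuous (m i))
    (hli : ∀ c : ι → ℝ, (∀ x ∈ TT, ∑ i, c i * m i x = 0) → c = 0) (l : XX →L[ℝ] ℝ) (M : ι → ℝ) :
    ∃ z ∈ HH, ∃ c : ι → ℝ, (∀ v ∈ HH, aa z v = l v + ∑ i, c i * mo (hm i) v) ∧
      ∀ i, mo (hm i) z = M i := by
  classical
  obtain ⟨z0, hz0, e0⟩ := solve l
  choose z hz e using fun i => solve (mo (hm i))
  let A : Matrix ι ι ℝ := fun i j => mo (hm i) (z j)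
  have hA : ∀ c i, A.mulVec c i = mo (hm i) (∑ j, c j • z j) := by
    intro c i
    simp only [Matrix.mulVec, dotProduct, A, map_sum, map_smul, smul_eq_mul]
    exact Finset.sum_congr rfl fun j _ => mul_comm _ _
  have hmem : ∀ c : ι → ℝ, ∑ j, c j • z j ∈ HH := fun c =>
    Submodule.sum_mem _ fun j _ => Submodule.smul_mem _ _ (hz j)
  have haa : ∀ c : ι → ℝ, ∀ v ∈ HH, aa (∑ j, c j • z j) v = ∑ j, c j * mo (hm j) v := by
    intro c v hv
    rw [aa_sum_left]
    exact Finset.sum_congr rfl fun j _ => by rw [aa_smul_left, e j v hv]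
  have hinj : Function.Injective (Matrix.toLin' A) := by
    rw [injective_iff_map_eq_zero]
    intro c hc
    have hc' : ∀ i, mo (hm i) (∑ j, c j • z j) = 0 := fun i => by
      rw [← hA]; exact congrFun hc i
    have hz0 : ∑ j, c j • z j = 0 := by
      refine aa_zero (hmem c) ?_
      rw [haa c _ (hmem c)]
      exact Finset.sum_eq_zero fun j _ => by rw [hc' j, mul_zero]
    refine hli c (zero_of_test (by fun_prop) fun φ hφ => ?_)
    have h1 := haa c _ (jet_mem hφ)
    rw [hz0] at h1
    have h2 : aa 0 (jet hφ) = 0 := by simp [aa]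
    rw [h2] at h1
    simp_rw [mo_jet] at h1
    simp_rw [Finset.sum_mul]
    rw [integral_finsetSum]
    · rw [h1]
      exact Finset.sum_congr rfl fun j _ => by rw [← integral_const_mul]; simp only [mul_assoc]
    · intro i _
      exact integrableOn_TT _ (by have := hφ.sm.continuous; have := hm i; fun_prop)
  obtain ⟨c, hc⟩ := (LinearMap.injective_iff_surjective.1 hinj) fun i => M i - mo (hm i) z0
  refine ⟨z0 + ∑ j, c j • z j, Submodule.add_mem _ hz0 (hmem c), c, fun v hv => ?_, fun i => ?_⟩
  · rw [aa_add_left, e0 v hv, haa c v hv]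
  · have := congrFun hc i
    rw [Matrix.toLin'_apply, hA] at this
    rw [map_add, this]
    ring


/-! ### Polynomials of degree at most `k - 4` -/

abbrev MI (k : ℕ) := {p : Fin k × Fin k // (p.1 : ℕ) + p.2 + 4 ≤ k}

def ex (a b : ℕ) : Fin 2 →₀ ℕ := Finsupp.equivFunOnFinite.symm ![a, b]

lemma ex_inj {a b a' b' : ℕ} (h : ex a b = ex a' b') : a = a' ∧ b = b' := by
  have h0 := DFunLike.congr_fun h 0
  have h1 := DFunLike.congr_fun h 1
  simp [ex] at h0 h1
  exact ⟨h0, h1⟩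

def mon (a b : ℕ) (x : E2) : ℝ := x 0 ^ a * x 1 ^ b

lemma mon_cont (a b : ℕ) : Continuous (mon a b) := by unfold mon; fun_prop

def QQ {k : ℕ} (c : MI k → ℝ) : MvPolynomial (Fin 2) ℝ :=
  ∑ p : MI k, MvPolynomial.monomial (ex p.1.1 p.1.2) (c p)

lemma QQ_eval {k : ℕ} (c : MI k → ℝ) (x : Fin 2 → ℝ) :
    MvPolynomial.eval x (QQ c) = ∑ p : MI k, c p * (x 0 ^ (p.1.1 : ℕ) * x 1 ^ (p.1.2 : ℕ)) := by
  simp only [QQ, map_sum, MvPolynomial.eval_monomial]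
  refine Finset.sum_congr rfl fun p _ => ?_
  rw [Finsupp.prod_fintype _ _ (by simp)]
  simp [ex]

lemma QQ_coeff {k : ℕ} (c : MI k → ℝ) (p : MI k) : MvPolynomial.coeff (ex p.1.1 p.1.2) (QQ c) = c p := by
  classical
  simp only [QQ, MvPolynomial.coeff_sum, MvPolynomial.coeff_monomial]
  rw [Finset.sum_eq_single p]
  · simp
  · intro q _ hq
    refine if_neg fun h => hq ?_
    obtain ⟨h1, h2⟩ := ex_inj h
    exact Subtype.ext (Prod.ext (Fin.ext h1) (Fin.ext h2))
  · simp

lemma QQ_poly {k : ℕ} (c : MI k → ℝ) :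
    IsPoly2DegLe ((k : ℤ) - 4) (fun x => ∑ p : MI k, c p * mon p.1.1 p.1.2 x) := by
  classical
  refine ⟨QQ c, fun d hd => ?_, fun x => ?_⟩
  · simp only [QQ, MvPolynomial.coeff_sum, MvPolynomial.coeff_monomial]
    refine Finset.sum_eq_zero fun p _ => if_neg fun h => ?_
    have := p.2
    rw [← h] at hd
    simp [ex] at hd
    omega
  · rw [QQ_eval]; rfl

lemma mon_li {k : ℕ} (c : MI k → ℝ) (h : ∀ x ∈ TT, ∑ p : MI k, c p * mon p.1.1 p.1.2 x = 0) : c = 0 := by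
  have : QQ c = 0 := by
    refine MvPolynomial.funext_set (fun _ => Ioo (0:ℝ) (1/2)) (fun _ => Ioo_infinite (by norm_num)) fun x hx => ?_
    have h0 := hx 0 (mem_univ _)
    have h1 := hx 1 (mem_univ _)
    rw [map_zero, QQ_eval]
    exact h !₂[x 0, x 1] ⟨h0.1, h1.1, by have := h0.2; have := h1.2; simp; linarith⟩
  funext p
  rw [← QQ_coeff c p, this]; simp

lemma poly_cont {m : ℤ} {ρ : E2 → ℝ} (h : IsPoly2DegLe m ρ) : Continuous ρ := by
  obtain ⟨Q, _, hQ⟩ := h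
  have : ρ = fun x : E2 => MvPolynomial.eval (fun i => x i) Q := funext hQ
  rw [this]
  exact (MvPolynomial.continuous_eval Q).comp (by fun_prop)

lemma poly_sub {m : ℤ} {ρ ρ' : E2 → ℝ} (h : IsPoly2DegLe m ρ) (h' : IsPoly2DegLe m ρ') :
    IsPoly2DegLe m (fun x => ρ' x - ρ x) := by
  obtain ⟨Q, a, hQ⟩ := h
  obtain ⟨Q', a', hQ'⟩ := h'
  refine ⟨Q' - Q, fun d hd => ?_, fun x => ?_⟩
  · rw [MvPolynomial.coeff_sub, a d hd, a' d hd, sub_zero]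
  · rw [map_sub, ← hQ, ← hQ']

lemma poly_mom {k : ℕ} {ρ η : E2 → ℝ} (h : IsPoly2DegLe ((k : ℤ) - 4) ρ) (hη : MemLp η 2 muT)
    (hm : ∀ a b : ℕ, ((a + b : ℕ) : ℤ) ≤ (k : ℤ) - 4 → ∫ x in TT, η x * mon a b x = 0) :
    ∫ x in TT, η x * ρ x = 0 := by
  obtain ⟨Q, a, hQ⟩ := h
  have e : ∀ x : E2, η x * ρ x = ∑ d ∈ Q.support, Q.coeff d * (η x * mon (d 0) (d 1) x) := by
    intro x
    rw [hQ, MvPolynomial.eval_eq', Finset.mul_sum]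
    refine Finset.sum_congr rfl fun d _ => ?_
    simp only [Fin.prod_univ_two, mon]; ring
  simp_rw [e]
  rw [integral_finsetSum]
  · refine Finset.sum_eq_zero fun d hd => ?_
    rw [integral_const_mul, hm, mul_zero]
    by_contra hlt
    exact (MvPolynomial.mem_support_iff.1 hd) (a d (not_le.1 hlt))
  · intro d _
    exact (int_mul_L2 hη (memLp_TC (mon_cont _ _).continuousOn)).const_mul _

/-! ### Assembling -/

lemma MemH2W.add' {ξ ξ' : E2 → ℝ} {G G' : Fin 2 → E2 → ℝ} {Hs Hs' : Fin 2 → Fin 2 → E2 → ℝ} (c : ℝ)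
    (h : MemH2W (tri refTri) ξ G Hs) (h' : MemH2W (tri refTri) ξ' G' Hs') :
    MemH2W (tri refTri) (fun x => ξ x + c * ξ' x) (fun d x => G d x + c * G' d x)
      (fun d d' x => Hs d d' x + c * Hs' d d' x) := by
  rw [tri_eq] at *
  have key : ∀ {u u' v v' : E2 → ℝ} {d : E2}, MemLp u 2 muT → MemLp u' 2 muT → MemLp v 2 muT → MemLp v' 2 muT →
      IsWeakD TT u v d → IsWeakD TT u' v' d → IsWeakD TT (fun x => u x + c * u' x) (fun x => v x + c * v' x) d := by
    intro u u' v v' d m1 m2 m3 m4 w1 w2 φ hφ hc hs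
    have e1 := w1 φ hφ hc hs
    have e2 := w2 φ hφ hc hs
    have cd := cont_pd hφ d
    simp_rw [add_mul, mul_assoc]
    have i1 := int_mul_test (int_of_L2 m1) cd (supp_pd hc d)
    have i2 := int_mul_test (int_of_L2 m2) cd (supp_pd hc d)
    have i3 := int_mul_test (int_of_L2 m3) hφ.continuous hc
    have i4 := int_mul_test (int_of_L2 m4) hφ.continuous hc
    rw [integral_add i1 (i2.const_mul c), integral_add i3 (i4.const_mul c), integral_const_mul,
      integral_const_mul, e1, e2]
    ring
  obtain ⟨a0, a1, a2⟩ := h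
  obtain ⟨b0, b1, b2⟩ := h'
  refine ⟨a0.add (b0.const_mul c), fun d => ⟨(a1 d).1.add ((b1 d).1.const_mul c), ?_⟩,
    fun d d' => ⟨(a2 d d').1.add ((b2 d d').1.const_mul c), ?_⟩⟩
  · exact key a0 b0 (a1 d).1 (b1 d).1 (a1 d).2 (b1 d).2
  · exact key (a1 d).1 (b1 d).1 (a2 d d').1 (b2 d d').1 (a2 d d').2 (b2 d d').2

lemma HasFaceTrace.add' {u u' : E2 → ℝ} {D D' : Fin 2 → E2 → ℝ} {b : Fin 3 → ℝ → ℝ}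
    (mu : MemLp u 2 muT) (mu' : MemLp u' 2 muT) (mD : ∀ d, MemLp (D d) 2 muT) (mD' : ∀ d, MemLp (D' d) 2 muT)
    (h : HasFaceTrace refTri u D b) (h' : W0 u' D') :
    HasFaceTrace refTri (fun x => u x + u' x) (fun d x => D d x + D' d x) b := by
  intro φ hφ hc d
  rw [← h φ hφ hc d, tri_eq, ← add_zero (∫ x in TT, (u x * _ + _)), ← h' φ hφ hc d, ← integral_add]
  · refine integral_congr_ae (Filter.Eventually.of_forall fun x => ?_)
    simp only [Pd]; ring
  · exact (int_mul_test (int_of_L2 mu) (cont_pd hφ _) (supp_pd hc _)).add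
      (int_mul_test (int_of_L2 (mD d)) hφ.continuous hc)
  · exact (int_mul_test (int_of_L2 mu') (cont_pd hφ _) (supp_pd hc _)).add
      (int_mul_test (int_of_L2 (mD' d)) hφ.continuous hc)

lemma HasFaceTrace.sub' {u u' : E2 → ℝ} {D D' : Fin 2 → E2 → ℝ} {b : Fin 3 → ℝ → ℝ}
    (mu : MemLp u 2 muT) (mu' : MemLp u' 2 muT) (mD : ∀ d, MemLp (D d) 2 muT) (mD' : ∀ d, MemLp (D' d) 2 muT)
    (h : HasFaceTrace refTri u D b) (h' : HasFaceTrace refTri u' D' b) :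
    W0 (fun x => u x + (-1) * u' x) (fun d x => D d x + (-1) * D' d x) := by
  intro φ hφ hc d
  have e := (h φ hφ hc d).trans (h' φ hφ hc d).symm
  rw [tri_eq] at e
  rw [← sub_eq_zero, ← integral_sub] at e
  · rw [← e]
    refine integral_congr_ae (Filter.Eventually.of_forall fun x => ?_)
    simp only [Pd]; ring
  · exact (int_mul_test (int_of_L2 mu) (cont_pd hφ _) (supp_pd hc _)).add
      (int_mul_test (int_of_L2 (mD d)) hφ.continuous hc)
  · exact (int_mul_test (int_of_L2 mu') (cont_pd hφ _) (supp_pd hc _)).add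
      (int_mul_test (int_of_L2 (mD' d)) hφ.continuous hc)

lemma W0.memH2W {J : XX} (h : ZT J) : MemH2W (tri refTri) (J j0) (fun d => J (j1 d)) (fun d d' => J (j2 d d')) := by
  have key : ∀ {u : E2 → ℝ} {D : Fin 2 → E2 → ℝ}, W0 u D → HasFaceTrace refTri u D (fun _ _ => 0) := by
    intro u D h φ hφ hc d
    rw [tri_eq]
    refine (h φ hφ hc d).trans ?_
    simp
  have e := tri_eq
  refine ⟨?_, fun d => ⟨?_, ?_⟩, fun d d' => ⟨?_, ?_⟩⟩
  · rw [e]; exact Lp.memLp _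
  · rw [e]; exact Lp.memLp _
  · exact (key h.1).isWeakD (L2T_int _) (fun d => L2T_int _) d
  · rw [e]; exact Lp.memLp _
  · exact (key (h.2 d)).isWeakD (L2T_int _) (fun d => L2T_int _) d'


lemma exist_xi {k : ℕ} {ξ0 : E2 → ℝ} {G0 : Fin 2 → E2 → ℝ} {H0 : Fin 2 → Fin 2 → E2 → ℝ} {f g : Fin 3 → ℝ → ℝ}
    (hG : Good ξ0 G0 H0) (hl : Lifts ξ0 G0 f g) (mT : ℕ → ℕ → ℝ) :
    ∃ ξ G Hs, MemH2W (tri refTri) ξ G Hs ∧ TraceW refTri ξ G Hs f g ∧ BiharmPoly refTri ((k : ℤ) - 4) ξ ∧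
      ∀ a b : ℕ, ((a + b : ℕ) : ℤ) ≤ (k : ℤ) - 4 → ∫ x in tri refTri, ξ x * (x 0 ^ a * x 1 ^ b) = mT a b := by
  have h0 := hG.memH2W
  have ht := hG.traceW hl
  let l : XX →L[ℝ] ℝ := -∑ d, ∑ d', (innerSL ℝ (toX h0 (j2 d d'))).comp (pr (j2 d d'))
  have hlv : ∀ v, l v = - aa (toX h0) v := by
    intro v
    simp [l, aa, pr_apply]
  obtain ⟨z, hz, c, e1, e2⟩ := moments (m := fun p : MI k => mon p.1.1 p.1.2) (fun p => mon_cont _ _) mon_li l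
    (fun p => mT p.1.1 p.1.2 - ∫ x in TT, ξ0 x * mon p.1.1 p.1.2 x)
  have hzt := ZT_of_mem_HH hz
  have h1 := W0.memH2W hzt
  have h := h0.add' 1 h1
  have hX : toX h = toX h0 + z := by
    ext i : 1
    refine Lp.ext ?_
    have q : (toX h0 + z) i = toX h0 i + z i := rfl
    rw [q]
    filter_upwards [toX_ae h i, toX_ae h0 i, Lp.coeFn_add (toX h0 i) (z i)] with x a1 a2 a3
    rw [a3, Pi.add_apply, a1, a2]
    rcases i with _ | d | ⟨d, d'⟩ <;> simp [dat]
  refine ⟨_, _, _, h, ?_, ?_, ?_⟩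
  · have h0' := h0
    rw [tri_eq] at h0'
    simp only [one_mul]
    refine ⟨ht.1.add' h0'.1 (Lp.memLp _) (fun d => (h0'.2.1 d).1) (fun d => Lp.memLp _) hzt.1,
      fun d => (ht.2 d).add' (h0'.2.1 d).1 (Lp.memLp _) (fun d' => (h0'.2.2 d d').1) (fun d => Lp.memLp _) (hzt.2 d)⟩
  · refine ⟨_, QQ_poly c, fun φ p1 p2 p3 => ?_⟩
    rw [tri_eq] at p3 ⊢
    have hφ : Tst φ := ⟨p1, p2, p3⟩
    rw [bilap_aa h hφ, hX, aa_add_left, e1 _ (jet_mem hφ), hlv]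
    simp_rw [mo_jet, Finset.sum_mul]
    rw [integral_finsetSum]
    · simp_rw [mul_assoc, integral_const_mul]
      ring
    · intro p _
      exact integrableOn_TT _ (by have := hφ.sm.continuous; have := mon_cont p.1.1 p.1.2; fun_prop)
  · intro a b hab
    rw [tri_eq] at *
    have ha : a < k := by omega
    have hb : b < k := by omega
    have := e2 ⟨(⟨a, ha⟩, ⟨b, hb⟩), by simp; omega⟩
    rw [mo_apply] at this
    simp only at this
    have i1 := int_mul_L2 h0.1 (memLp_TC (mon_cont a b).continuousOn)
    have i2 := int_mul_L2 (Lp.memLp (z j0)) (memLp_TC (mon_cont a b).continuousOn)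
    have e : ∀ x : E2, (ξ0 x + 1 * z j0 x) * (x 0 ^ a * x 1 ^ b) = ξ0 x * mon a b x + z j0 x * mon a b x := by
      intro x; simp only [mon]; ring
    simp_rw [e]
    rw [integral_add i1 i2, this]
    ring

lemma uniq_xi {k : ℕ} {ξ ξ' : E2 → ℝ} {G G' : Fin 2 → E2 → ℝ} {Hs Hs' : Fin 2 → Fin 2 → E2 → ℝ} {f g : Fin 3 → ℝ → ℝ}
    (h : MemH2W (tri refTri) ξ G Hs) (h' : MemH2W (tri refTri) ξ' G' Hs')
    (t : TraceW refTri ξ G Hs f g) (t' : TraceW refTri ξ' G' Hs' f g)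
    (b : BiharmPoly refTri ((k : ℤ) - 4) ξ) (b' : BiharmPoly refTri ((k : ℤ) - 4) ξ')
    (hm : ∀ a b : ℕ, ((a + b : ℕ) : ℤ) ≤ (k : ℤ) - 4 →
      ∫ x in tri refTri, ξ x * (x 0 ^ a * x 1 ^ b) = ∫ x in tri refTri, ξ' x * (x 0 ^ a * x 1 ^ b)) :
    ξ' =ᵐ[volume.restrict (tri refTri)] ξ := by
  have hd := h'.add' (-1) h
  have m := h
  have m' := h'
  rw [tri_eq] at m m'
  have hJ : toX hd ∈ HH := by
    refine mem_HH_of_ZT ⟨?_, fun d => ?_⟩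
    · exact (t'.1.sub' m'.1 m.1 (fun d => (m'.2.1 d).1) (fun d => (m.2.1 d).1) t.1).congr (toX_ae hd j0)
        fun d => toX_ae hd (j1 d)
    · exact ((t'.2 d).sub' (m'.2.1 d).1 (m.2.1 d).1 (fun d' => (m'.2.2 d d').1) (fun d' => (m.2.2 d d').1) (t.2 d)).congr
        (toX_ae hd (j1 d)) fun d' => toX_ae hd (j2 d d')
  obtain ⟨ρ, hρ, B⟩ := b
  obtain ⟨ρ', hρ', B'⟩ := b'
  rw [tri_eq] at B B' hm
  have hP := poly_sub hρ hρ'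
  have hc := poly_cont hP
  have key : ∀ v ∈ HH, aa (toX hd) v = mo hc v := by
    refine HH_induct (p := fun v => aa (toX hd) v = mo hc v) ?_ ?_
    · refine isClosed_eq ?_ (mo hc).continuous
      unfold aa
      exact continuous_finsetSum _ fun d _ => continuous_finsetSum _ fun d' _ =>
        continuous_const.inner (PiLp.continuous_apply 2 _ _)
    · intro φ hφ
      have hX : toX hd = toX h' + (-1 : ℝ) • toX h := by
        ext i : 1
        refine Lp.ext ?_
        have q : (toX h' + (-1 : ℝ) • toX h) i = toX h' i + (-1 : ℝ) • toX h i := rfl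
        rw [q]
        filter_upwards [toX_ae hd i, toX_ae h i, toX_ae h' i, Lp.coeFn_add (toX h' i) ((-1 : ℝ) • toX h i),
          Lp.coeFn_smul (-1 : ℝ) (toX h i)] with x a1 a2 a3 a4 a5
        rw [a4, Pi.add_apply, a5, Pi.smul_apply, a1, a2, a3]
        rcases i with _ | d | ⟨d, d'⟩ <;> simp [dat]
      rw [hX, aa_add_left, aa_smul_left, ← bilap_aa h' hφ, ← bilap_aa h hφ, B φ hφ.sm hφ.cs hφ.ts,
        B' φ hφ.sm hφ.cs hφ.ts, mo_jet]
      simp_rw [sub_mul]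
      rw [integral_sub]
      · ring
      · exact integrableOn_TT _ ((poly_cont hρ').mul hφ.sm.continuous).continuousOn
      · exact integrableOn_TT _ ((poly_cont hρ).mul hφ.sm.continuous).continuousOn
  have mη : MemLp (fun x => ξ' x + (-1) * ξ x) 2 muT := m'.1.add (m.1.const_mul (-1))
  have hz : toX hd = 0 := by
    refine aa_zero hJ ?_
    rw [key _ hJ, mo_apply, ← poly_mom hP mη]
    · refine integral_congr_ae ?_
      filter_upwards [toX_ae hd j0] with x hx
      rw [hx]; rfl
    · intro a b hab
      have e : ∀ x : E2, (ξ' x + (-1) * ξ x) * mon a b x = ξ' x * (x 0 ^ a * x 1 ^ b) - ξ x * (x 0 ^ a * x 1 ^ b) := by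
        intro x; simp only [mon]; ring
      simp_rw [e]
      rw [integral_sub, hm a b hab, sub_self]
      · exact int_mul_L2 m'.1 (memLp_TC (mon_cont a b).continuousOn)
      · exact int_mul_L2 m.1 (memLp_TC (mon_cont a b).continuousOn)
  rw [tri_eq]
  have a1 := toX_ae hd j0
  rw [hz] at a1
  have q : (0 : XX) j0 = 0 := rfl
  rw [q] at a1
  filter_upwards [a1, Lp.coeFn_zero ℝ 2 muT] with x h1 h2
  rw [h2] at h1
  simp [dat] at h1
  linarith

theorem vem_dimension_reference (k : ℕ) (hk : 3 ≤ k) :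
    -- 𝒱^k(T̂) is in bijection with the dof space (trace dofs plus interior moments):
    (∀ (vv : Fin 3 → ℝ) (w : Fin 3 → E2)
        (mf : Fin 3 → Fin (k - 3) → ℝ) (mg : Fin 3 → Fin (k - 2) → ℝ)
        (mT : ℕ → ℕ → ℝ),
      ∃ (ξ : E2 → ℝ) (f g : Fin 3 → ℝ → ℝ),
        (MemVEMT refTri k ξ f g ∧
          (∀ i j : Fin 3, j ≠ i →
            f j (tau i j) = vv i ∧
            derivWithin (f j) (Icc 0 1) (tau i j) = elen refTri j * ⟪w i, tangv refTri j⟫ ∧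
            g j (tau i j) = ⟪w i, norv refTri j⟫) ∧
          (∀ i (m : Fin (k - 3)), ∫ t in Ioo (0:ℝ) 1, f i t * t ^ (m : ℕ) = mf i m) ∧
          (∀ i (m : Fin (k - 2)), ∫ t in Ioo (0:ℝ) 1, g i t * t ^ (m : ℕ) = mg i m) ∧
          (∀ a b : ℕ, ((a + b : ℕ) : ℤ) ≤ (k : ℤ) - 4 →
            ∫ x in tri refTri, ξ x * (x 0 ^ a * x 1 ^ b) = mT a b)) ∧
        -- uniqueness
        (∀ (ξ' : E2 → ℝ) (f' g' : Fin 3 → ℝ → ℝ),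
          (MemVEMT refTri k ξ' f' g' ∧
            (∀ i j : Fin 3, j ≠ i →
              f' j (tau i j) = vv i ∧
              derivWithin (f' j) (Icc 0 1) (tau i j) = elen refTri j * ⟪w i, tangv refTri j⟫ ∧
              g' j (tau i j) = ⟪w i, norv refTri j⟫) ∧
            (∀ i (m : Fin (k - 3)), ∫ t in Ioo (0:ℝ) 1, f' i t * t ^ (m : ℕ) = mf i m) ∧
            (∀ i (m : Fin (k - 2)), ∫ t in Ioo (0:ℝ) 1, g' i t * t ^ (m : ℕ) = mg i m) ∧
            (∀ a b : ℕ, ((a + b : ℕ) : ℤ) ≤ (k : ℤ) - 4 →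
              ∫ x in tri refTri, ξ' x * (x 0 ^ a * x 1 ^ b) = mT a b)) →
          f' = f ∧ g' = g ∧ ξ' =ᵐ[volume.restrict (tri refTri)] ξ)) ∧
    -- dim 𝒱^k(T̂) = dim (H²×H¹)_{k,k-1}(∂T̂) + dim P_{k-4}(T̂) = (k² + 7k - 6)/2
    6 * (k - 1) + (k - 3) * (k - 2) / 2 = (k * k + 7 * k - 6) / 2 := by
  refine ⟨fun vv w mf mg mT => ?_, dim_arith k hk⟩
  obtain ⟨f, g, hBD, ξ0, G0, ⟨H0, hG⟩, hl⟩ := bd_ex hk vv w mf mg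
  obtain ⟨ξ, G, Hs, h, t, b, m⟩ := exist_xi (k := k) hG hl mT
  refine ⟨ξ, f, g, ⟨⟨hBD.1, hBD.compat, G, Hs, h, t, b⟩, hBD.2.1, hBD.2.2.1, hBD.2.2.2, m⟩, ?_⟩
  rintro ξ' f' g' ⟨⟨q1, q2, G', Hs', h', t', b'⟩, v', mf', mg', m'⟩
  obtain ⟨rfl, rfl⟩ := bd_uniq hk hBD (show BD k vv w mf mg f' g' from ⟨q1, v', mf', mg'⟩)
  exact ⟨rfl, rfl, uniq_xi h h' t t' b b' fun a b hab => (m a b hab).trans (m' a b hab).symm⟩
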